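/- arXiv:1910.01725 — 5 statements merged into one kernel-verified Lean document; each statement's English description precedes it below -/
import Mathlib

section
/- Let m ≥ 1 and let ρ be a real number. Define the m × m real matrices: S with S_{i,i+1} = 1 for 0 ≤ i ≤ m−2, last row S_{m−1,k} = −C(m,k)·(−ρ²)^{m−k} for 0 ≤ k ≤ m−1, and all other entries 0; B₀ with entries (B₀)_{k,j} = c_{2k,j} · ρ^{2k−j} for 0 ≤ k, j ≤ m−1 (terms with c_{2k,j} = 0 understood as 0); and the upper triangular matrix M with M_{j,j} = ρ², M_{j−1,j} = 2jρ (for j ≥ 1), M_{j−2,j} = j(j−1) (for j ≥ 2), and all other entries 0. Then S·B₀ = B₀·M. -/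
open Polynomial in
noncomputable def bb (ρ : ℝ) (k j : ℕ) : ℝ := (derivative^[j] ((X : ℝ[X]) ^ (2 * k))).eval ρ

open Polynomial in
lemma bb_eq (ρ : ℝ) (k j : ℕ) :
    bb ρ k j = ((2 * k).descFactorial j : ℝ) * ρ ^ (2 * k - j) := by
  simp [bb, iterate_derivative_X_pow_eq_natCast_mul]

open Polynomial in
lemma bb_succ (ρ : ℝ) (k j : ℕ) :
    bb ρ (k + 1) j = ρ ^ 2 * bb ρ k j + 2 * j * ρ * bb ρ k (j - 1)
      + j * ((j : ℝ) - 1) * bb ρ k (j - 2) := by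
  have h : (X : ℝ[X]) ^ (2 * (k + 1)) = X ^ (2 * k) * X * X := by ring
  unfold bb
  rw [h, iterate_derivative_mul_X, iterate_derivative_mul_X, iterate_derivative_mul_X]
  rcases j with _ | j
  · simp; ring
  · simp [Nat.sub_sub]; ring

open Polynomial in
lemma bb_sum (ρ : ℝ) (m j : ℕ) (hj : j < m) :
    ∑ k ∈ Finset.range m, -(m.choose k : ℝ) * (-ρ ^ 2) ^ (m - k) * bb ρ k j = bb ρ m j := by
  have h0 : (derivative^[j] (((X : ℝ[X]) ^ 2 + C (-ρ ^ 2)) ^ m)).eval ρ = 0 := by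
    have hd : ((X : ℝ[X]) - C ρ) ^ m ∣ ((X : ℝ[X]) ^ 2 + C (-ρ ^ 2)) ^ m := by
      apply pow_dvd_pow_of_dvd
      exact ⟨X + C ρ, by simp only [map_neg, map_pow]; ring⟩
    have h1 := pow_sub_dvd_iterate_derivative_of_pow_dvd j hd
    have h2 : ((X : ℝ[X]) - C ρ) ∣ _ := (dvd_pow_self _ (by omega)).trans h1
    exact dvd_iff_isRoot.mp h2
  rw [add_pow, iterate_derivative_sum, eval_finsetSum, Finset.sum_range_succ] at h0
  have h3 : ∀ k, (derivative^[j] (((X : ℝ[X]) ^ 2) ^ k * C (-ρ ^ 2) ^ (m - k) *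
      (m.choose k : ℝ[X]))).eval ρ = (m.choose k : ℝ) * (-ρ ^ 2) ^ (m - k) * bb ρ k j := by
    intro k
    have : ((X : ℝ[X]) ^ 2) ^ k * C (-ρ ^ 2) ^ (m - k) * (m.choose k : ℝ[X])
        = C ((m.choose k : ℝ) * (-ρ ^ 2) ^ (m - k)) * X ^ (2 * k) := by
      rw [C_mul, C_pow, ← pow_mul, map_natCast]; ring
    rw [this, iterate_derivative_C_mul, eval_mul, eval_C, bb]
  simp only [h3] at h0
  simp only [neg_mul, Finset.sum_neg_distrib]
  simp at h0 ⊢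
  linarith


/-- with `c k j = Nat.descFactorial k j`, the matrices
`S` (superdiagonal `1`, last row `-C(m,k)(-ρ²)^{m-k}`, other entries `0`),
`B₀` with `(B₀)_{k,j} = c_{2k,j} ρ^{2k-j}`, and the upper triangular `M` with
`M_{j,j} = ρ²`, `M_{j-1,j} = 2jρ`, `M_{j-2,j} = j(j-1)`, other entries `0`,
satisfy `S · B₀ = B₀ · M`. -/
theorem stmt5 (m : ℕ) (hm : 1 ≤ m) (ρ : ℝ)
    (S B₀ M : Matrix (Fin m) (Fin m) ℝ)
    (hS : S = Matrix.of fun i j : Fin m =>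
      if (i : ℕ) + 1 = (j : ℕ) then 1
      else if (i : ℕ) = m - 1 then -(m.choose (j : ℕ) : ℝ) * (-ρ ^ 2) ^ (m - (j : ℕ))
      else 0)
    (hB₀ : B₀ = Matrix.of fun k j : Fin m =>
      ((2 * (k : ℕ)).descFactorial (j : ℕ) : ℝ) * ρ ^ (2 * (k : ℕ) - (j : ℕ)))
    (hM : M = Matrix.of fun i j : Fin m =>
      if (i : ℕ) = (j : ℕ) then ρ ^ 2
      else if (i : ℕ) + 1 = (j : ℕ) then 2 * (j : ℕ) * ρ
      else if (i : ℕ) + 2 = (j : ℕ) then (j : ℕ) * ((j : ℕ) - 1)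
      else 0) :
    S * B₀ = B₀ * M := by
  subst hS hB₀ hM
  ext i j
  obtain ⟨i, hi⟩ := i
  obtain ⟨j, hj⟩ := j
  simp only [Matrix.mul_apply, Matrix.of_apply, ← bb_eq]
  rw [Fin.sum_univ_eq_sum_range (fun k => (if i + 1 = k then (1 : ℝ)
      else if i = m - 1 then -(m.choose k : ℝ) * (-ρ ^ 2) ^ (m - k) else 0) * bb ρ k j) m,
    Fin.sum_univ_eq_sum_range (fun k => bb ρ i k * (if k = j then ρ ^ 2
      else if k + 1 = j then 2 * (j : ℝ) * ρ
      else if k + 2 = j then (j : ℝ) * ((j : ℝ) - 1) else 0)) m]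
  trans bb ρ (i + 1) j
  · by_cases h : i = m - 1
    · have hm' : i + 1 = m := by omega
      rw [hm', ← bb_sum ρ m j hj]
      apply Finset.sum_congr rfl
      intro k hk
      have := Finset.mem_range.mp hk
      rw [if_neg (by omega), if_pos h]
    · simp only [if_neg h, ite_mul, one_mul, zero_mul]
      rw [Finset.sum_ite_eq, if_pos (Finset.mem_range.mpr (by omega))]
  · rw [bb_succ]
    have hk : ∀ k ∈ Finset.range m, bb ρ i k * (if k = j then ρ ^ 2
      else if k + 1 = j then 2 * (j : ℝ) * ρ
      else if k + 2 = j then (j : ℝ) * ((j : ℝ) - 1) else 0) =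
        (if k = j then ρ ^ 2 * bb ρ i j else 0)
        + (if k = j - 1 then 2 * j * ρ * bb ρ i (j - 1) else 0)
        + (if k = j - 2 then j * ((j : ℝ) - 1) * bb ρ i (j - 2) else 0) := by
      intro k _
      rcases j with _ | _ | j
      · by_cases h : k = 0 <;> simp [h]; ring
      · rcases k with _ | _ | k <;> simp <;> ring
      · by_cases h : k = j + 2
        · subst h; simp; ring
        by_cases h : k = j + 1
        · subst h; simp; ring
        by_cases h : k = j
        · subst h
          rw [if_neg (by omega), if_neg (by omega), if_pos rfl, if_neg (by omega),
            if_neg (by omega), if_pos (by omega)]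
          simp; ring
        simp [*]
    rw [Finset.sum_congr rfl hk, Finset.sum_add_distrib, Finset.sum_add_distrib,
      Finset.sum_ite_eq', Finset.sum_ite_eq', Finset.sum_ite_eq',
      if_pos (Finset.mem_range.mpr (by omega)), if_pos (Finset.mem_range.mpr (by omega)),
      if_pos (Finset.mem_range.mpr (by omega))]
end

section
/- Let m ≥ 1 and let ρ be a nonzero real number. Then the m × m matrix B₀ with entries (B₀)_{k,j} = c_{2k,j} · ρ^{2k−j} for 0 ≤ k, j ≤ m−1 (terms with c_{2k,j} = 0 understood as 0) is invertible. -/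
/-- with `c k j = Nat.descFactorial k j`, for `ρ ≠ 0` the `m × m` matrix
`B₀` with entries `(B₀)_{k,j} = c_{2k,j} ρ^{2k-j}` is invertible. -/
theorem stmt6 (m : ℕ) (hm : 1 ≤ m) (ρ : ℝ) (hρ : ρ ≠ 0) :
    IsUnit (Matrix.of fun k j : Fin m =>
      ((2 * (k : ℕ)).descFactorial (j : ℕ) : ℝ) * ρ ^ (2 * (k : ℕ) - (j : ℕ))) := by
  have hfac : (Matrix.of fun k j : Fin m =>
      ((2 * (k : ℕ)).descFactorial (j : ℕ) : ℝ) * ρ ^ (2 * (k : ℕ) - (j : ℕ))) =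
      Matrix.diagonal (fun k : Fin m => ρ ^ (2 * (k : ℕ))) *
      (Matrix.of fun k j : Fin m =>
        (descPochhammer ℝ (j : ℕ)).eval (((2 * (k : ℕ) : ℕ)) : ℝ)) *
      Matrix.diagonal (fun j : Fin m => (ρ ^ (j : ℕ))⁻¹) := by
    ext k j
    rw [Matrix.mul_diagonal, Matrix.diagonal_mul, Matrix.of_apply, Matrix.of_apply,
      descPochhammer_eval_eq_descFactorial]
    rcases le_or_gt (j : ℕ) (2 * (k : ℕ)) with h | h
    · rw [pow_sub₀ ρ hρ h]
      ring
    · simp [Nat.descFactorial_of_lt h]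
  rw [hfac, Matrix.isUnit_iff_isUnit_det, isUnit_iff_ne_zero, Matrix.det_mul, Matrix.det_mul,
    Matrix.det_diagonal, Matrix.det_diagonal,
    ← Matrix.det_eval_matrixOfPolynomials_eq_det_vandermonde
      (fun k : Fin m => ((2 * (k : ℕ) : ℕ) : ℝ)) (fun j : Fin m => descPochhammer ℝ (j : ℕ))
      (fun i => descPochhammer_natDegree ℝ i) (fun i => monic_descPochhammer ℝ i)]
  refine mul_ne_zero (mul_ne_zero ?_ ?_) ?_
  · exact Finset.prod_ne_zero_iff.mpr fun i _ => pow_ne_zero _ hρ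
  · rw [Matrix.det_vandermonde_ne_zero_iff]
    intro a b hab
    have h : 2 * (a : ℕ) = 2 * (b : ℕ) := Nat.cast_injective (R := ℝ) hab
    exact Fin.ext (by omega)
  · exact Finset.prod_ne_zero_iff.mpr fun i _ => inv_ne_zero (pow_ne_zero _ hρ)
end

section
/- Let m ≥ 1, let ρ be a nonzero real number, and let q₀, q₁, ..., q_{m−1} be real numbers with q_{m−1} ≠ 0. For each natural number s define p_{2s} = ∑_{j=0}^{m−1} c_{2s,j} · ρ^{2s−j} · q_j (terms with c_{2s,j} = 0 understood as 0). Then the m × m Hankel matrix A₀ with entries (A₀)_{k,l} = p_{2(k+l)} for 0 ≤ k, l ≤ m−1 is invertible. -/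
open Polynomial in
theorem aux_mult (m : ℕ) (ρ : ℝ) (n : ℕ) (hn : m = n + 1) (q : Fin m → ℝ) (hq : q ⟨n, by omega⟩ ≠ 0)
    (G : ℝ[X]) (hG : G.eval ρ ≠ 0) :
    ∑ j : Fin m, q j * ((derivative^[(j : ℕ)] ((X - C ρ) ^ n * G)).eval ρ) ≠ 0 := by
  subst hn
  set F : ℝ[X] := (X - C ρ) ^ n * G with hF
  have hX : (X - C ρ : ℝ[X]) ≠ 0 := X_sub_C_ne_zero ρ
  have hG0 : G ≠ 0 := by rintro rfl; simp at hG
  have hF0 : F ≠ 0 := mul_ne_zero (pow_ne_zero _ hX) hG0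
  have h1 : n ≤ F.rootMultiplicity ρ := (le_rootMultiplicity_iff hF0).2 ⟨G, rfl⟩
  have h2 : ¬ n < F.rootMultiplicity ρ := by
    intro h
    have h3 : (X - C ρ) ^ (n + 1) ∣ F := (le_rootMultiplicity_iff hF0).1 h
    rw [hF, pow_succ] at h3
    have h4 := (mul_dvd_mul_iff_left (pow_ne_zero n hX)).1 h3
    exact hG (dvd_iff_isRoot.1 h4)
  have hz : ∀ j < n, (derivative^[j] F).eval ρ = 0 := fun j hj =>
    isRoot_iterate_derivative_of_lt_rootMultiplicity (lt_of_lt_of_le hj h1)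
  have hnz : (derivative^[n] F).eval ρ ≠ 0 := by
    intro h
    apply h2
    rw [lt_rootMultiplicity_iff_isRoot_iterate_derivative hF0]
    intro k hk
    rcases hk.lt_or_eq with hk | rfl
    · exact hz k hk
    · exact h
  rw [Fin.sum_univ_castSucc, Finset.sum_eq_zero, zero_add]
  · exact mul_ne_zero hq hnz
  · intro j _
    rw [hz _ (by simp), mul_zero]

open Polynomial in
/-- with `c k j = Nat.descFactorial k j`, `ρ ≠ 0`, `q_{m-1} ≠ 0` and
`p_{2s} = ∑_{j=0}^{m-1} c_{2s,j} ρ^{2s-j} q_j`, the `m × m` Hankel matrix `A₀` with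
entries `(A₀)_{k,l} = p_{2(k+l)}` is invertible.  Here `p s` denotes `p_{2s}`. -/
theorem stmt9 (m : ℕ) (hm : 1 ≤ m) (ρ : ℝ) (hρ : ρ ≠ 0)
    (q : Fin m → ℝ) (hq : q ⟨m - 1, by omega⟩ ≠ 0) (p : ℕ → ℝ)
    (hp : ∀ s : ℕ, p s = ∑ j : Fin m,
      ((2 * s).descFactorial (j : ℕ) : ℝ) * ρ ^ (2 * s - (j : ℕ)) * q j) :
    IsUnit (Matrix.of fun k l : Fin m => p ((k : ℕ) + (l : ℕ))) := by
  rw [Matrix.isUnit_iff_isUnit_det, isUnit_iff_ne_zero]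
  intro hdet
  obtain ⟨v, hv0, hv⟩ := Matrix.exists_mulVec_eq_zero_iff.2 hdet
  let L : ℝ[X] →ₗ[ℝ] ℝ := ∑ j : Fin m, q j • ((leval ρ).comp (derivative ^ (j : ℕ)))
  have hL : ∀ f, L f = ∑ j : Fin m, q j * ((derivative^[(j : ℕ)] f).eval ρ) := by
    intro f
    simp [L, LinearMap.sum_apply, Module.End.pow_apply, leval]
  have hLp : ∀ s, L (X ^ (2 * s)) = p s := by
    intro s
    rw [hL, hp]
    refine Finset.sum_congr rfl fun j _ => ?_
    rw [iterate_derivative_X_pow_eq_natCast_mul]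
    simp
    ring
  set V : ℝ[X] := ∑ l : Fin m, C (v l) * X ^ (l : ℕ) with hV
  have hVdeg : V.degree < m := degree_sum_fin_lt v
  have hV0 : V ≠ 0 := by
    intro h
    apply hv0
    funext i
    have := congrArg (fun P => coeff P (i : ℕ)) h
    simpa [hV, finsetSum_coeff, coeff_X_pow, Fin.val_inj] using this
  have hVn : V.natDegree < m := (natDegree_lt_iff_degree_lt hV0).2 hVdeg
  have hLW : ∀ W : ℝ[X], W.natDegree < m → L (expand ℝ 2 (W * V)) = 0 := by
    intro W hW
    have hk : ∀ k : Fin m, L (expand ℝ 2 (X ^ (k : ℕ) * V)) = 0 := by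
      intro k
      have h := congrFun hv k
      simp only [Matrix.mulVec, dotProduct, Matrix.of_apply, Pi.zero_apply] at h
      rw [← h, hV, Finset.mul_sum, map_sum, map_sum]
      refine Finset.sum_congr rfl fun l _ => ?_
      rw [← hLp]
      have : expand ℝ 2 (X ^ (k : ℕ) * (C (v l) * X ^ (l : ℕ)))
          = v l • X ^ (2 * ((k : ℕ) + l)) := by
        simp only [map_mul, map_pow, expand_X, expand_C, smul_eq_C_mul]
        ring
      rw [this, map_smul, smul_eq_mul, mul_comm]
    rw [as_sum_range_C_mul_X_pow' W hW, Finset.sum_range, Finset.sum_mul, map_sum, map_sum]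
    refine Finset.sum_eq_zero fun k _ => ?_
    rw [mul_assoc, map_mul, expand_C, ← smul_eq_C_mul, map_smul, hk, smul_zero]
  obtain ⟨U, hU, hUr⟩ := exists_eq_pow_rootMultiplicity_mul_and_not_dvd V hV0 (ρ ^ 2)
  set r := V.rootMultiplicity (ρ ^ 2)
  have hr : r ≤ m - 1 := by
    have : r ≤ V.natDegree := by
      simpa using (count_roots V (a := ρ ^ 2)).symm.le.trans
        ((Multiset.count_le_card _ _).trans (card_roots' V))
    omega
  have hW := hLW ((X - C (ρ ^ 2)) ^ (m - 1 - r)) (by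
    rw [natDegree_pow, natDegree_X_sub_C]; omega)
  have hE : expand ℝ 2 ((X - C (ρ ^ 2)) ^ (m - 1 - r) * V)
      = (X - C ρ) ^ (m - 1) * ((X + C ρ) ^ (m - 1) * expand ℝ 2 U) := by
    rw [hU, ← mul_assoc, ← pow_add, Nat.sub_add_cancel hr, map_mul, map_pow, ← mul_assoc,
      ← mul_pow]
    congr 2
    simp only [map_sub, expand_X, C_pow, map_pow, expand_C]
    ring
  rw [hE, hL] at hW
  refine aux_mult m ρ (m - 1) (by omega) q hq _ ?_ hW
  rw [eval_mul, eval_pow, expand_eval]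
  refine mul_ne_zero (pow_ne_zero _ ?_) ?_
  · simpa [← two_mul] using hρ
  · exact fun h => hUr (dvd_iff_isRoot.2 h)
end

section
/- Let n ≥ 2 and m ≥ 1. Let ρ : S^{n−1} → ℝ be a continuous, strictly positive function on the unit sphere of ℝⁿ, and let q₀, q₁, ..., q_{m−1} : S^{n−1} → ℝ be continuous functions, not all identically zero. Assume that for every natural number k there exists a homogeneous polynomial p_{2k} of degree 2k in n real variables such that ∑_{j=0}^{m−1} c_{2k,j} · ρ(ω)^{2k−j} · q_j(ω) = p_{2k}(ω) for every ω ∈ S^{n−1}. Then there exists a polynomial Q of degree at most 2 in n real variables, not identically zero, such that ρ(ω)² = Q(ω) for all ω ∈ S^{n−1}. -/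
open scoped RealInnerProductSpace

open Polynomial in
/-- Hankel nondegeneracy. -/
theorem hankel_det_ne_zero (s : ℕ) (A : ℝ[X]) (hA : A ≠ 0) (hs : A.natDegree = s) (x : ℝ)
    (hx : x ≠ 0) :
    (Matrix.of fun i j : Fin (s + 1) =>
      x ^ ((i : ℕ) + j) * A.eval (((i + j : ℕ) : ℕ) : ℝ)).det ≠ 0 := by
  intro hdet
  obtain ⟨c, hc0, hc⟩ := Matrix.exists_mulVec_eq_zero_iff.mpr hdet
  apply hc0
  set c' : Fin (s + 1) → ℝ := fun j => c j * x ^ (j : ℕ) with hc'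
  set B : ℝ[X] := ∑ j, C (c' j) * taylor ((j : ℕ) : ℝ) A with hB
  have hBdeg : B.natDegree < s + 1 := by
    refine Nat.lt_succ_of_le (natDegree_sum_le_of_forall_le _ _ fun j _ => ?_)
    refine (natDegree_C_mul_le _ _).trans ?_
    rw [natDegree_taylor, hs]
  have hB0 : B = 0 := by
    refine eq_zero_of_natDegree_lt_card_of_eval_eq_zero B
      (f := fun i : Fin (s + 1) => ((i : ℕ) : ℝ)) ?_ ?_ (by simpa using hBdeg)
    · intro i j h
      exact Fin.ext (by simpa using h)
    · intro i
      have h := congrFun hc i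
      simp only [Matrix.mulVec, dotProduct, Matrix.of_apply, Pi.zero_apply] at h
      have h2 : x ^ (i : ℕ) * B.eval ((i : ℕ) : ℝ) = 0 := by
        rw [← h, hB, eval_finsetSum, Finset.mul_sum]
        refine Finset.sum_congr rfl fun j _ => ?_
        simp only [hc', eval_mul, eval_C, taylor_eval, Nat.cast_add, pow_add]
        ring
      exact (mul_eq_zero.mp h2).resolve_left (pow_ne_zero _ hx)
  have hD : ∀ l, ∑ j, c' j * (hasseDeriv l A).eval ((j : ℕ) : ℝ) = 0 := by
    intro l
    have := congrArg (fun p => p.coeff l) hB0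
    simpa [hB, finsetSum_coeff, coeff_C_mul, taylor_coeff] using this
  have hpow : ∀ l, l ≤ s → ∑ j, c' j * ((j : ℕ) : ℝ) ^ l = 0 := by
    intro l
    induction l using Nat.strong_induction_on with
    | _ l ih =>
      intro hl
      have h := hD (s - l)
      have hdeg : (hasseDeriv (s - l) A).natDegree < l + 1 := by
        have := natDegree_hasseDeriv_le A (s - l)
        omega
      simp only [eval_eq_sum_range' hdeg, Finset.mul_sum] at h
      rw [Finset.sum_comm, Finset.sum_range_succ, Finset.sum_eq_zero, zero_add] at h
      · have h3 : (hasseDeriv (s - l) A).coeff l * ∑ j, c' j * ((j : ℕ) : ℝ) ^ l = 0 := by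
          rw [← h, Finset.mul_sum]
          exact Finset.sum_congr rfl fun j _ => by ring
        refine (mul_eq_zero.mp h3).resolve_left ?_
        rw [hasseDeriv_coeff, Nat.add_sub_cancel' hl]
        refine mul_ne_zero ?_ ?_
        · exact_mod_cast (Nat.choose_pos (Nat.sub_le _ _)).ne'
        · rw [← hs]
          exact leadingCoeff_ne_zero.mpr hA
      · intro i hi
        have hi' := Finset.mem_range.mp hi
        have := ih i hi' (by omega)
        calc _ = (hasseDeriv (s - l) A).coeff i * ∑ j, c' j * ((j : ℕ) : ℝ) ^ i := by
              rw [Finset.mul_sum]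
              exact Finset.sum_congr rfl fun j _ => by ring
          _ = 0 := by rw [this, mul_zero]
  have hv : c' = 0 := by
    refine Matrix.eq_zero_of_forall_pow_sum_mul_pow_eq_zero
      (f := fun i : Fin (s + 1) => ((i : ℕ) : ℝ)) ?_ fun i => hpow i (by omega)
    intro i j h
    exact Fin.ext (by simpa using h)
  funext j
  have := congrFun hv j
  simp only [hc', Pi.zero_apply] at this
  exact (mul_eq_zero.mp this).resolve_right (pow_ne_zero _ hx)

open Polynomial in
theorem diff_zero (A : ℝ[X]) (N : ℕ) (h : A.natDegree < N) (y : ℝ) :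
    ∑ i ∈ Finset.range (N + 1), (-1 : ℝ) ^ (N - i) * N.choose i * A.eval (y + i) = 0 := by
  have h1 := congrFun (Polynomial.fwdDiff_iter_eq_zero_of_degree_lt h) y
  rw [fwdDiff_iter_eq_sum_shift] at h1
  simpa using h1

open Polynomial in
theorem newton (A : ℝ[X]) (s : ℕ) (h : A.natDegree ≤ s) (k : ℕ) (hk : s ≤ k) :
    A.eval (k : ℝ) = ∑ i ∈ Finset.range (s + 1), (k.choose i : ℝ) *
      ∑ j ∈ Finset.range (i + 1), (-1 : ℝ) ^ (i - j) * i.choose j * A.eval (j : ℝ) := by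
  have h1 := shift_eq_sum_fwdDiff_iter (1 : ℝ) A.eval k 0
  simp only [zero_add, nsmul_eq_mul, mul_one] at h1
  rw [h1]
  symm
  have h2 : ∀ i, (fwdDiff (1 : ℝ))^[i] A.eval 0 =
      ∑ j ∈ Finset.range (i + 1), (-1 : ℝ) ^ (i - j) * i.choose j * A.eval (j : ℝ) := by
    intro i
    rw [fwdDiff_iter_eq_sum_shift]
    simp
  simp only [← h2]
  refine Finset.sum_subset (Finset.range_mono (by omega)) fun i _ hi => ?_
  have hi' : s + 1 ≤ i := by simpa using hi
  rw [Polynomial.fwdDiff_iter_eq_zero_of_degree_lt (by omega : A.natDegree < i)]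
  simp

/-- polynomials agreeing off a hypersurface agree -/
theorem mvpoly_eq_of {n : ℕ} (i0 : Fin n) (g p q : MvPolynomial (Fin n) ℝ) (hg : g ≠ 0)
    (h : ∀ v : Fin n → ℝ, v ≠ 0 → MvPolynomial.eval v g ≠ 0 →
      MvPolynomial.eval v p = MvPolynomial.eval v q) : p = q := by
  have : (p - q) * (g * MvPolynomial.X i0) = 0 := by
    apply MvPolynomial.funext
    intro v
    by_cases hv : v = 0
    · simp [hv]
    by_cases hgv : MvPolynomial.eval v g = 0
    · simp [hgv]
    · simp [h v hv hgv]
  have h2 := (mul_eq_zero.mp this).resolve_right (mul_ne_zero hg (MvPolynomial.X_ne_zero _))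
  exact sub_eq_zero.mp h2

theorem eval_smul_homog {n d : ℕ} (p : MvPolynomial (Fin n) ℝ) (hp : p.IsHomogeneous d)
    (t : ℝ) (v : Fin n → ℝ) :
    MvPolynomial.eval (t • v) p = t ^ d * MvPolynomial.eval v p := by
  rw [MvPolynomial.eval_eq', MvPolynomial.eval_eq', Finset.mul_sum]
  refine Finset.sum_congr rfl fun e he => ?_
  have h1 := hp (MvPolynomial.mem_support_iff.mp he)
  have h2 : ∑ i, e i = d := by
    rw [← h1, Finsupp.weight_apply, Finsupp.sum_fintype _ _ (by simp)]
    simp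
  simp only [Pi.smul_apply, smul_eq_mul, mul_pow, Finset.prod_mul_distrib,
    Finset.prod_pow_eq_pow_sum, h2]
  ring

theorem homog_part {n d : ℕ} (Q : MvPolynomial (Fin n) ℝ) (v : Fin n → ℝ)
    (h : ∀ t : ℝ, 0 < t → MvPolynomial.eval (t • v) Q = t ^ d * MvPolynomial.eval v Q) :
    MvPolynomial.eval v (MvPolynomial.homogeneousComponent d Q) = MvPolynomial.eval v Q := by
  open Polynomial in
  set R : ℝ[X] := ∑ i ∈ Finset.range (Q.totalDegree + 1),
    C (MvPolynomial.eval v (MvPolynomial.homogeneousComponent i Q)) * X ^ i with hR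
  have hev : ∀ t : ℝ, 0 < t →
      R.eval t = (Polynomial.C (MvPolynomial.eval v Q) * Polynomial.X ^ d).eval t := by
    intro t ht
    have := h t ht
    rw [← MvPolynomial.sum_homogeneousComponent Q, map_sum,
      MvPolynomial.sum_homogeneousComponent Q] at this
    simp only [hR, Polynomial.eval_finsetSum, Polynomial.eval_mul, Polynomial.eval_C,
      Polynomial.eval_pow, Polynomial.eval_X]
    rw [mul_comm (MvPolynomial.eval v Q), ← this]
    refine Finset.sum_congr rfl fun i _ => ?_
    rw [eval_smul_homog _ (MvPolynomial.homogeneousComponent_isHomogeneous i Q)]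
    ring
  have hRe : R = Polynomial.C (MvPolynomial.eval v Q) * Polynomial.X ^ d := by
    apply Polynomial.eq_of_infinite_eval_eq
    refine Set.Infinite.mono (s := Set.Ioi 0) ?_ (Set.Ioi_infinite (0 : ℝ))
    intro t ht
    exact hev t ht
  have := congrArg (fun p => Polynomial.coeff p d) hRe
  simp only [hR, Polynomial.finsetSum_coeff, Polynomial.coeff_C_mul, Polynomial.coeff_X_pow] at this
  simp only [mul_ite, mul_one, mul_zero, Finset.sum_ite_eq, if_true, Finset.mem_range] at this
  rw [← this]
  split_ifs with hd
  · rfl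
  · rw [MvPolynomial.homogeneousComponent_eq_zero _ _ (by omega)]
    simp

/-- `ρ²` is a quotient of polynomials. -/
theorem rational_step {n : ℕ} (s : ℕ) (x : (Fin n → ℝ) → ℝ)
    (A : (Fin n → ℝ) → Polynomial ℝ) (P : ℕ → MvPolynomial (Fin n) ℝ)
    (hx : ∀ v, v ≠ 0 → x v ≠ 0)
    (hP : ∀ k v, v ≠ 0 → MvPolynomial.eval v (P k) = x v ^ k * (A v).eval (k : ℝ))
    (hA : ∀ v, v ≠ 0 → (A v).natDegree ≤ s)
    (v0 : Fin n → ℝ) (hv0 : v0 ≠ 0) (hA0 : A v0 ≠ 0) (hs : (A v0).natDegree = s) :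
    ∃ T H : MvPolynomial (Fin n) ℝ, H ≠ 0 ∧
      ∀ v, v ≠ 0 → MvPolynomial.eval v T = x v * MvPolynomial.eval v H := by
  set M : Matrix (Fin (s + 1)) (Fin (s + 1)) (MvPolynomial (Fin n) ℝ) :=
    Matrix.of fun i j => P ((i : ℕ) + j) with hM
  set b : Fin (s + 1) → MvPolynomial (Fin n) ℝ := fun i => - P ((i : ℕ) + (s + 1)) with hb
  have hMv : ∀ v, v ≠ 0 → (MvPolynomial.eval v).mapMatrix M =
      Matrix.of fun i j : Fin (s + 1) =>
        x v ^ ((i : ℕ) + j) * (A v).eval (((i + j : ℕ) : ℕ) : ℝ) := by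
    intro v hv
    ext i j
    simp [hM, hP _ v hv]
  refine ⟨MvPolynomial.C (-((s : ℝ) + 1)⁻¹) * (M.adjugate.mulVec b) (Fin.last s), M.det, ?_, ?_⟩
  · intro h0
    have h1 := hankel_det_ne_zero s (A v0) hA0 hs (x v0) (hx v0 hv0)
    rw [← hMv v0 hv0, ← RingHom.map_det, h0] at h1
    simp at h1
  · intro v hv
    set e : Fin (s + 1) → ℝ := fun i =>
      (-1 : ℝ) ^ (s + 1 - (i : ℕ)) * (s + 1).choose i * x v ^ (s + 1 - (i : ℕ)) with he
    set M' := (MvPolynomial.eval v).mapMatrix M with hM'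
    have hMe : M'.mulVec e = fun i => MvPolynomial.eval v (b i) := by
      funext i
      have h := diff_zero (A v) (s + 1) (Nat.lt_succ_of_le (hA v hv)) ((i : ℕ) : ℝ)
      rw [Finset.sum_range_succ] at h
      rw [hM', hMv v hv]
      simp only [Matrix.mulVec, dotProduct, Matrix.of_apply, hb, map_neg, hP _ v hv]
      rw [eq_neg_iff_add_eq_zero]
      have h' := congrArg (fun z => x v ^ ((i : ℕ) + (s + 1)) * z) h
      simp only [mul_zero, mul_add, Finset.mul_sum] at h'
      rw [← h', ← Fin.sum_univ_eq_sum_range (fun j => x v ^ ((i : ℕ) + (s + 1)) *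
        ((-1 : ℝ) ^ (s + 1 - j) * (s + 1).choose j * (A v).eval (((i : ℕ) : ℝ) + (j : ℕ)))) (s + 1)]
      congr 1
      · refine Finset.sum_congr rfl fun j _ => ?_
        have hj : (i : ℕ) + (s + 1) = (i + j) + (s + 1 - (j : ℕ)) := by omega
        rw [hj, pow_add (x v) (i + j)]
        simp only [he]
        push_cast
        ring
      · simp
    have h1 : M'.adjugate.mulVec (M'.mulVec e) = M'.det • e := by
      rw [Matrix.mulVec_mulVec, Matrix.adjugate_mul, Matrix.smul_mulVec, Matrix.one_mulVec]
    have h2 := congrFun h1 (Fin.last s)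
    rw [hMe] at h2
    have h3 : MvPolynomial.eval v ((M.adjugate.mulVec b) (Fin.last s)) =
        M'.adjugate.mulVec (fun i => MvPolynomial.eval v (b i)) (Fin.last s) := by
      rw [hM', ← RingHom.map_adjugate]
      simp [Matrix.mulVec, dotProduct]
    rw [map_mul, h3, h2, RingHom.map_det, MvPolynomial.eval_C, Pi.smul_apply, smul_eq_mul]
    have h4 : e (Fin.last s) = - (((s : ℝ) + 1) * x v) := by
      simp [he]
      ring
    rw [h4, ← hM']
    have : (s : ℝ) + 1 ≠ 0 := by positivity
    field_simp

/-- `ρ²` agrees with a polynomial wherever the denominator is nonzero. -/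
theorem division_step {n : ℕ} (i0 : Fin n) (s : ℕ) (x : (Fin n → ℝ) → ℝ)
    (A : (Fin n → ℝ) → Polynomial ℝ) (P : ℕ → MvPolynomial (Fin n) ℝ)
    (hx : ∀ v, v ≠ 0 → x v ≠ 0)
    (hP : ∀ k v, v ≠ 0 → MvPolynomial.eval v (P k) = x v ^ k * (A v).eval (k : ℝ))
    (hA : ∀ v, v ≠ 0 → (A v).natDegree ≤ s)
    (v0 : Fin n → ℝ) (hv0 : v0 ≠ 0) (hA0 : A v0 ≠ 0)
    (T H : MvPolynomial (Fin n) ℝ) (hH : H ≠ 0)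
    (hTH : ∀ v, v ≠ 0 → MvPolynomial.eval v T = x v * MvPolynomial.eval v H) :
    H ∣ T := by
  obtain ⟨H', T', g, hrel, hH', hT'⟩ := UniqueFactorizationMonoid.exists_reduced_factors H hH T
  have hg : g ≠ 0 := by
    rintro rfl
    simp at hH'
    exact hH hH'.symm
  have hH'0 : H' ≠ 0 := by
    rintro rfl
    simp at hH'
    exact hH hH'.symm
  have hTH' : ∀ v, v ≠ 0 → MvPolynomial.eval v g ≠ 0 →
      MvPolynomial.eval v T' = x v * MvPolynomial.eval v H' := by
    intro v hv hgv
    have := hTH v hv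
    rw [← hT', ← hH', map_mul, map_mul] at this
    apply mul_left_cancel₀ hgv
    rw [this]
    ring
  set G : ℕ → MvPolynomial (Fin n) ℝ := fun i =>
    ∑ j ∈ Finset.range (i + 1), MvPolynomial.C ((-1 : ℝ) ^ (i - j) * i.choose j) *
      (P j * T' ^ (s - j) * H' ^ j) with hG
  set F : ℕ → MvPolynomial (Fin n) ℝ := fun k =>
    ∑ i ∈ Finset.range (s + 1), MvPolynomial.C (k.choose i : ℝ) * G i with hF
  have hkey : ∀ k, s ≤ k → T' ^ s * H' ^ k * P k = T' ^ k * F k := by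
    intro k hk
    refine mvpoly_eq_of i0 g _ _ hg fun v hv hgv => ?_
    have hFv : MvPolynomial.eval v (F k) =
        (x v * MvPolynomial.eval v H') ^ s * (A v).eval (k : ℝ) := by
      rw [newton (A v) s (hA v hv) k hk]
      simp only [hF, hG, map_sum, map_mul, MvPolynomial.eval_C, map_pow, hP _ v hv,
        hTH' v hv hgv, Finset.mul_sum]
      refine Finset.sum_congr rfl fun i hi => Finset.sum_congr rfl fun j hj => ?_
      have h1 : i < s + 1 := Finset.mem_range.mp hi
      have h2 : j < i + 1 := Finset.mem_range.mp hj
      obtain ⟨r, rfl⟩ : ∃ r, s = r + j := ⟨s - j, by omega⟩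
      rw [Nat.add_sub_cancel]
      ring
    simp only [map_mul, map_pow, hFv, hP _ v hv, hTH' v hv hgv]
    ring
  have hT'0 : T' ≠ 0 := by
    rintro rfl
    apply hH'0
    refine mvpoly_eq_of i0 g _ _ hg fun v hv hgv => ?_
    have := hTH' v hv hgv
    simp only [map_zero] at this ⊢
    exact (mul_eq_zero.mp this.symm).resolve_left (hx v hv)
  have hdvd : ∀ k, s ≤ k → H' ^ k ∣ F k := by
    intro k hk
    have h1 : H' ^ k ∣ T' ^ k * F k := by
      rw [← hkey k hk]
      exact ⟨T' ^ s * P k, by ring⟩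
    have h2 : IsRelPrime (H' ^ k) (T' ^ k) := by
      have : IsRelPrime H' T' := hrel
      exact IsRelPrime.pow this
    exact h2.dvd_of_dvd_mul_left h1
  -- uniform degree bound
  obtain ⟨d, hd⟩ : ∃ d, ∀ k, (F k).totalDegree ≤ d := by
    refine ⟨(Finset.range (s + 1)).sup fun i => (G i).totalDegree, fun k => ?_⟩
    refine MvPolynomial.totalDegree_finsetSum_le fun i hi => ?_
    refine (MvPolynomial.totalDegree_mul _ _).trans ?_
    rw [MvPolynomial.totalDegree_C, zero_add]
    exact Finset.le_sup (f := fun i => (G i).totalDegree) hi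
  -- some large `k` with `P k ≠ 0`
  obtain ⟨k, hkd, hPk⟩ : ∃ k, s + d + 1 ≤ k ∧ P k ≠ 0 := by
    by_contra hcon
    push Not at hcon
    apply hA0
    apply Polynomial.eq_zero_of_infinite_isRoot
    refine Set.Infinite.mono (s := (fun k : ℕ => (k : ℝ)) '' Set.Ici (s + d + 1)) ?_ ?_
    · rintro _ ⟨k, hk, rfl⟩
      have h1 := hP k v0 hv0
      rw [hcon k hk, map_zero] at h1
      exact (mul_eq_zero.mp h1.symm).resolve_left (pow_ne_zero _ (hx v0 hv0))
    · exact (Set.Ici_infinite _).image Nat.cast_injective.injOn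
  have hFk : F k ≠ 0 := by
    intro h0
    have := hkey k (by omega)
    rw [h0, mul_zero] at this
    exact mul_ne_zero (mul_ne_zero (pow_ne_zero _ hT'0) (pow_ne_zero _ hH'0)) hPk this
  obtain ⟨w, hw⟩ := hdvd k (by omega)
  have hw0 : w ≠ 0 := by
    rintro rfl
    exact hFk (by rw [hw, mul_zero])
  have hdeg : ∀ j, (H' ^ j).totalDegree = j * H'.totalDegree := by
    intro j
    induction j with
    | zero => simp
    | succ j ih =>
      rw [pow_succ, MvPolynomial.totalDegree_mul_of_isDomain (pow_ne_zero _ hH'0) hH'0, ih]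
      ring
  have hz : H'.totalDegree = 0 := by
    by_contra hne
    have h1 := hd k
    rw [hw, MvPolynomial.totalDegree_mul_of_isDomain (pow_ne_zero _ hH'0) hw0, hdeg] at h1
    have : k ≤ k * H'.totalDegree := Nat.le_mul_of_pos_right _ (Nat.pos_of_ne_zero hne)
    omega
  have hunit : IsUnit H' := by
    rw [MvPolynomial.totalDegree_eq_zero_iff_eq_C] at hz
    rw [hz]
    refine IsUnit.map _ (isUnit_iff_ne_zero.mpr ?_)
    intro h0
    rw [h0] at hz
    exact hH'0 (by simpa using hz)
  rw [← hH', ← hT']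
  exact mul_dvd_mul_left g hunit.dvd

theorem density_step {n : ℕ} (x : (Fin n → ℝ) → ℝ) (hxc : ContinuousOn x {0}ᶜ)
    (Q H : MvPolynomial (Fin n) ℝ) (hH : H ≠ 0)
    (h : ∀ v, v ≠ 0 → MvPolynomial.eval v H ≠ 0 → MvPolynomial.eval v Q = x v)
    (v : Fin n → ℝ) (hv : v ≠ 0) : MvPolynomial.eval v Q = x v := by
  obtain ⟨u, hu⟩ : ∃ u, MvPolynomial.eval u H ≠ 0 := by
    by_contra hcon
    push Not at hcon
    exact hH (MvPolynomial.funext fun u => by simpa using hcon u)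
  open Polynomial in
  set R : ℝ[X] := MvPolynomial.aeval (fun i => C (v i) + X * C (u i - v i)) H with hR
  have hRe : ∀ t : ℝ, R.eval t = MvPolynomial.eval (v + t • (u - v)) H := by
    intro t
    rw [hR, ← Polynomial.coe_evalRingHom, MvPolynomial.aeval_def, MvPolynomial.hom_eval₂,
      MvPolynomial.eval, MvPolynomial.coe_eval₂Hom]
    congr 1
    · ext r
      simp
    · funext i
      simp
  have hR0 : R ≠ 0 := by
    intro h0
    apply hu
    have := hRe 1
    rw [h0] at this
    simpa using this.symm
  have hline : Continuous fun t : ℝ => v + t • (u - v) := by fun_prop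
  have hev1 : ∀ᶠ t : ℝ in nhdsWithin 0 {0}ᶜ, R.eval t ≠ 0 := by
    have hfin : {t : ℝ | R.IsRoot t}.Finite := Polynomial.finite_setOfPred_isRoot hR0
    have h1 : ({t : ℝ | R.IsRoot t} \ {0})ᶜ ∈ nhds (0 : ℝ) :=
      (hfin.subset Set.sdiff_subset).isClosed.isOpen_compl.mem_nhds (by simp)
    filter_upwards [nhdsWithin_le_nhds h1, self_mem_nhdsWithin] with t ht ht0 hroot
    exact ht ⟨hroot, ht0⟩
  have hev2 : ∀ᶠ t : ℝ in nhdsWithin 0 {0}ᶜ, v + t • (u - v) ≠ 0 := by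
    apply Filter.Eventually.filter_mono nhdsWithin_le_nhds
    exact hline.continuousAt.eventually_ne (by simpa using hv)
  have hl : Filter.Tendsto (fun t : ℝ => v + t • (u - v)) (nhdsWithin 0 {0}ᶜ) (nhds v) := by
    have := hline.tendsto 0
    simp only [zero_smul, add_zero] at this
    exact this.mono_left nhdsWithin_le_nhds
  have hxv : ContinuousAt x v := hxc.continuousAt (isOpen_compl_singleton.mem_nhds hv)
  have ht1 := hxv.tendsto.comp hl
  have ht2 := ((MvPolynomial.continuous_eval Q).tendsto v).comp hl
  refine tendsto_nhds_unique (ht2.congr' ?_) ht1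
  filter_upwards [hev1, hev2] with t h1 h2
  exact h _ h2 (by rwa [← hRe])

theorem core {n : ℕ} (i0 : Fin n) (s : ℕ) (x : (Fin n → ℝ) → ℝ)
    (A : (Fin n → ℝ) → Polynomial ℝ) (P : ℕ → MvPolynomial (Fin n) ℝ)
    (hxc : ContinuousOn x {0}ᶜ)
    (hx : ∀ v, v ≠ 0 → x v ≠ 0)
    (hP : ∀ k v, v ≠ 0 → MvPolynomial.eval v (P k) = x v ^ k * (A v).eval (k : ℝ))
    (hA : ∀ v, v ≠ 0 → (A v).natDegree ≤ s)
    (v0 : Fin n → ℝ) (hv0 : v0 ≠ 0) (hA0 : A v0 ≠ 0) (hs : (A v0).natDegree = s) :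
    ∃ Q : MvPolynomial (Fin n) ℝ, ∀ v, v ≠ 0 → MvPolynomial.eval v Q = x v := by
  obtain ⟨T, H, hH, hTH⟩ := rational_step s x A P hx hP hA v0 hv0 hA0 hs
  obtain ⟨Q, rfl⟩ := division_step i0 s x A P hx hP hA v0 hv0 hA0 T H hH hTH
  refine ⟨Q, density_step x hxc Q H hH fun v hv hHv => ?_⟩
  have := hTH v hv
  rw [map_mul, mul_comm] at this
  exact mul_right_cancel₀ hHv this

open Polynomial in
/-- the polynomial `∑ c_j · (2Y)(2Y-1)⋯(2Y-j+1)`. -/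
noncomputable def apoly {m : ℕ} (c : Fin m → ℝ) : ℝ[X] :=
  (∑ j : Fin m, C (c j) * descPochhammer ℝ (j : ℕ)).comp (C 2 * X)

open Polynomial in
theorem apoly_eval {m : ℕ} (c : Fin m → ℝ) (k : ℕ) :
    (apoly c).eval (k : ℝ) = ∑ j : Fin m, c j * ((2 * k).descFactorial (j : ℕ) : ℝ) := by
  have h : (2 : ℝ) * k = ((2 * k : ℕ) : ℝ) := by push_cast; ring
  simp only [apoly, eval_comp, eval_mul, eval_C, eval_X, eval_finsetSum, h,
    descPochhammer_eval_eq_descFactorial]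

open Polynomial in
theorem apoly_natDegree_le {m : ℕ} (c : Fin m → ℝ) : (apoly c).natDegree ≤ m := by
  unfold apoly
  refine natDegree_comp_le.trans ?_
  have h1 : (∑ j : Fin m, C (c j) * descPochhammer ℝ (j : ℕ)).natDegree ≤ m := by
    refine natDegree_sum_le_of_forall_le _ _ fun j _ => ?_
    refine (natDegree_C_mul_le _ _).trans ?_
    rw [descPochhammer_natDegree]
    exact j.2.le
  have h2 : (C (2 : ℝ) * X).natDegree ≤ 1 := (natDegree_C_mul_le _ _).trans natDegree_X_le
  calc _ ≤ m * 1 := Nat.mul_le_mul h1 h2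
    _ = m := mul_one m

open Polynomial in
theorem apoly_eq_zero {m : ℕ} (c : Fin m → ℝ) (h : apoly c = 0) (j : Fin m) : c j = 0 := by
  have h0 : (∑ j : Fin m, C (c j) * descPochhammer ℝ (j : ℕ)) = 0 := by
    apply Polynomial.funext
    intro r
    have := congrArg (eval (r / 2)) h
    simp only [apoly, eval_comp, eval_mul, eval_C, eval_X, eval_zero] at this
    rw [mul_div_cancel₀ r (by norm_num : (2 : ℝ) ≠ 0)] at this
    rw [this, eval_zero]
  obtain ⟨j, hj⟩ := j
  induction j using Nat.strong_induction_on with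
  | _ j ih =>
    have h1 := congrArg (eval (j : ℝ)) h0
    simp only [eval_finsetSum, eval_mul, eval_C, descPochhammer_eval_eq_descFactorial,
      eval_zero] at h1
    rw [Finset.sum_eq_single (⟨j, hj⟩ : Fin m)] at h1
    · refine (mul_eq_zero.mp h1).resolve_right ?_
      rw [Nat.descFactorial_self]
      exact_mod_cast j.factorial_ne_zero
    · rintro ⟨i, hi⟩ _ hne
      have hne' : i ≠ j := fun h => hne (by simp [h])
      rcases lt_or_gt_of_ne hne' with hlt | hgt
      · rw [ih i hlt hi, zero_mul]
      · simp [Nat.descFactorial_of_lt hgt]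
    · simp

theorem stmt11 (n : ℕ) (hn : 2 ≤ n) (m : ℕ) (hm : 1 ≤ m)
    (ρ : Metric.sphere (0 : EuclideanSpace ℝ (Fin n)) 1 → ℝ)
    (hρcont : Continuous ρ) (hρpos : ∀ ω, 0 < ρ ω)
    (q : Fin m → Metric.sphere (0 : EuclideanSpace ℝ (Fin n)) 1 → ℝ)
    (hqcont : ∀ j, Continuous (q j))
    (hqne : ¬ ∀ j ω, q j ω = 0)
    (hp : ∀ k : ℕ, ∃ p : MvPolynomial (Fin n) ℝ, p.IsHomogeneous (2 * k) ∧
      ∀ ω : Metric.sphere (0 : EuclideanSpace ℝ (Fin n)) 1,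
        ∑ j : Fin m, ((2 * k).descFactorial (j : ℕ) : ℝ) * ρ ω ^ (2 * k - (j : ℕ)) * q j ω =
          MvPolynomial.eval (fun i => (ω : EuclideanSpace ℝ (Fin n)) i) p) :
    ∃ Q : MvPolynomial (Fin n) ℝ, Q ≠ 0 ∧ Q.totalDegree ≤ 2 ∧
      ∀ ω : Metric.sphere (0 : EuclideanSpace ℝ (Fin n)) 1,
        ρ ω ^ 2 = MvPolynomial.eval (fun i => (ω : EuclideanSpace ℝ (Fin n)) i) Q := by
  classical
  choose P hPh hPe using hp
  let E := EuclideanSpace ℝ (Fin n)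
  have i0 : Fin n := ⟨0, by omega⟩
  obtain ⟨j1, ω1, hω1⟩ : ∃ j ω, q j ω ≠ 0 := by
    by_contra hcon
    push Not at hcon
    exact hqne hcon
  -- radial projection
  let pr : (Fin n → ℝ) → Metric.sphere (0 : E) 1 := fun v =>
    if h : v = 0 then ω1 else ⟨‖(WithLp.toLp 2 v : E)‖⁻¹ • (WithLp.toLp 2 v : E), by
      have : (WithLp.toLp 2 v : E) ≠ 0 := by simpa using h
      simp [norm_smul, this]⟩
  let N : (Fin n → ℝ) → ℝ := fun v => ‖(WithLp.toLp 2 v : E)‖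
  have hN : ∀ v, v ≠ 0 → N v ≠ 0 := by
    intro v hv
    simpa [N] using hv
  have hprv : ∀ v, v ≠ 0 → v = N v • (fun i => (pr v : E) i) := by
    intro v hv
    funext i
    have := hN v hv
    simp only [pr, hv, dif_neg, not_false_eq_true, Pi.smul_apply, PiLp.smul_apply, smul_eq_mul]
    change v i = N v * ((N v)⁻¹ * v i)
    field_simp
  have hprω : ∀ (ω : Metric.sphere (0 : E) 1) (t : ℝ), 0 < t →
      t • (fun i => (ω : E) i) ≠ 0 ∧ N (t • (fun i => (ω : E) i)) = t ∧
        pr (t • (fun i => (ω : E) i)) = ω := by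
    intro ω t ht
    have hω : ‖(ω : E)‖ = 1 := by simp
    have hto : (WithLp.toLp 2 (t • (fun i => (ω : E) i)) : E) = t • (ω : E) := by
      ext i
      rfl
    have hNt : N (t • (fun i => (ω : E) i)) = t := by
      simp only [N, hto, norm_smul, hω, Real.norm_eq_abs, abs_of_pos ht, mul_one]
    have hne : t • (fun i => (ω : E) i) ≠ 0 := by
      intro h0
      rw [h0] at hNt
      simp [N] at hNt
      exact ht.ne hNt
    refine ⟨hne, hNt, ?_⟩
    apply Subtype.ext
    simp only [pr, hne, dif_neg, not_false_eq_true]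
    rw [hto, norm_smul, hω, Real.norm_eq_abs, abs_of_pos ht, mul_one, smul_smul,
      inv_mul_cancel₀ ht.ne', one_smul]
  let c : Metric.sphere (0 : E) 1 → Fin m → ℝ := fun ω j => (ρ ω)⁻¹ ^ (j : ℕ) * q j ω
  let x : (Fin n → ℝ) → ℝ := fun v => (N v * ρ (pr v)) ^ 2
  let A : (Fin n → ℝ) → Polynomial ℝ := fun v => apoly (c (pr v))
  -- a point of maximal degree
  obtain ⟨ω0, hω0, hmax⟩ : ∃ ω0, apoly (c ω0) ≠ 0 ∧
      ∀ ω, (apoly (c ω)).natDegree ≤ (apoly (c ω0)).natDegree := by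
    have hne : ∃ d ω, apoly (c ω) ≠ 0 ∧ (apoly (c ω)).natDegree = d := by
      refine ⟨_, ω1, ?_, rfl⟩
      intro h0
      have := apoly_eq_zero _ h0 j1
      simp only [c] at this
      exact hω1 ((mul_eq_zero.mp this).resolve_left
        (pow_ne_zero _ (inv_ne_zero (hρpos ω1).ne')))
    obtain ⟨ω2, h2, h2'⟩ := Nat.findGreatest_spec (n := m)
      (P := fun d => ∃ ω, apoly (c ω) ≠ 0 ∧ (apoly (c ω)).natDegree = d)
      (m := hne.choose) (by
        obtain ⟨ω, _, h⟩ := hne.choose_spec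
        rw [← h]
        exact apoly_natDegree_le _) hne.choose_spec
    refine ⟨ω2, h2, fun ω => ?_⟩
    by_cases hz : apoly (c ω) = 0
    · simp [hz]
    rw [h2']
    exact Nat.le_findGreatest (apoly_natDegree_le _) ⟨ω, hz, rfl⟩
  have hx : ∀ v, v ≠ 0 → x v ≠ 0 := fun v hv =>
    pow_ne_zero _ (mul_ne_zero (hN v hv) (hρpos _).ne')
  have hxc : ContinuousOn x {0}ᶜ := by
    have hNc : Continuous N := by
      have : Continuous fun v : Fin n → ℝ => (WithLp.toLp 2 v : E) :=
        PiLp.continuous_toLp 2 _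
      exact this.norm
    have hprc : ContinuousOn pr {0}ᶜ := by
      rw [Topology.IsInducing.subtypeVal.continuousOn_iff]
      have h1 : ContinuousOn (fun v : Fin n → ℝ => (N v)⁻¹ • (WithLp.toLp 2 v : E)) {0}ᶜ := by
        refine ContinuousOn.smul (hNc.continuousOn.inv₀ fun v hv => hN v hv) ?_
        exact (PiLp.continuous_toLp 2 _).continuousOn
      refine h1.congr fun v hv => ?_
      have hv' : v ≠ 0 := hv
      simp only [Function.comp, pr, hv', dif_neg, not_false_eq_true, N]
    exact (hNc.continuousOn.mul (hρcont.comp_continuousOn hprc)).pow 2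
  have hP : ∀ k v, v ≠ 0 → MvPolynomial.eval v (P k) = x v ^ k * (A v).eval (k : ℝ) := by
    intro k v hv
    have h1 : MvPolynomial.eval v (P k) =
        N v ^ (2 * k) * MvPolynomial.eval (fun i => (pr v : E) i) (P k) := by
      conv_lhs => rw [hprv v hv]
      exact eval_smul_homog _ (hPh k) _ _
    rw [h1, ← hPe k (pr v), apoly_eval]
    simp only [x]
    rw [← pow_mul, mul_pow, mul_assoc]
    congr 1
    rw [Finset.mul_sum]
    refine Finset.sum_congr rfl fun j _ => ?_
    have hρ := (hρpos (pr v)).ne'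
    by_cases hj : (j : ℕ) ≤ 2 * k
    · have : ρ (pr v) ^ (2 * k - (j : ℕ)) = ρ (pr v) ^ (2 * k) * (ρ (pr v))⁻¹ ^ (j : ℕ) := by
        rw [pow_sub₀ _ hρ hj, inv_pow]
      rw [this]
      simp only [c]
      ring
    · rw [Nat.descFactorial_of_lt (by omega)]
      simp
  obtain ⟨hv0, _, hpr0⟩ := hprω ω0 1 one_pos
  obtain ⟨Q, hQ⟩ := core i0 (apoly (c ω0)).natDegree x A P hxc hx hP (fun v _ => hmax _)
    _ hv0 (by simpa only [A, hpr0] using hω0) (by simp only [A, hpr0])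
  have hfin : ∀ ω : Metric.sphere (0 : E) 1, MvPolynomial.eval (fun i => (ω : E) i)
      (MvPolynomial.homogeneousComponent 2 Q) = ρ ω ^ 2 := by
    intro ω
    have hval : ∀ t : ℝ, 0 < t → MvPolynomial.eval (t • fun i => (ω : E) i) Q =
        t ^ 2 * ρ ω ^ 2 := by
      intro t ht
      obtain ⟨a, b, d⟩ := hprω ω t ht
      rw [hQ _ a]
      simp only [x, b, d, mul_pow]
    have h1 := hval 1 one_pos
    simp only [one_smul, one_pow, one_mul] at h1
    rw [homog_part, h1]
    intro t ht
    rw [h1]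
    exact hval t ht
  refine ⟨MvPolynomial.homogeneousComponent 2 Q, ?_,
    (MvPolynomial.homogeneousComponent_isHomogeneous 2 Q).totalDegree_le, fun ω => (hfin ω).symm⟩
  intro h0
  have := hfin ω1
  rw [h0, map_zero] at this
  exact (pow_ne_zero 2 (hρpos ω1).ne') this.symm
end

section
/- Let n ≥ 2 and let D ⊂ ℝⁿ be an open, bounded, convex set with D = −D and D nonempty. Suppose there exists a natural number N such that for every unit vector ω ∈ S^{n−1} there is a real polynomial P_ω of degree at most N with vol(D ∩ {x ∈ ℝⁿ : ⟨x, ω⟩ < p}) = P_ω(p) for all p in the open interval (inf{⟨x, ω⟩ : x ∈ D}, sup{⟨x, ω⟩ : x ∈ D}). Then D is an ellipsoid: there exists an invertible linear map T : ℝⁿ → ℝⁿ such that D = T(B), where B is the open unit ball of ℝⁿ. -/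
open scoped RealInnerProductSpace

section Algebra
open Polynomial

/-- The shift operator on sequences. -/
noncomputable def Sh (R : Type*) [CommRing R] : Module.End R (ℕ → R) :=
  LinearMap.funLeft R R Nat.succ

lemma Sh_pow (R : Type*) [CommRing R] (i : ℕ) (E : ℕ → R) (m : ℕ) :
    ((Sh R) ^ i) E m = E (m + i) := by
  induction i generalizing m with
  | zero => simp
  | succ i ih =>
    rw [pow_succ']
    change ((Sh R ^ i) E) (Nat.succ m) = _
    rw [ih]; congr 1; omega

/-- A polynomial acting on sequences through the shift operator. -/
noncomputable def act {R : Type*} [CommRing R] (p : R[X]) (E : ℕ → R) : ℕ → R :=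
  aeval (Sh R) p E

lemma act_mul {R : Type*} [CommRing R] (p q : R[X]) (E : ℕ → R) :
    act (p * q) E = act p (act q E) := by
  simp [act, Module.End.mul_apply]

lemma act_add {R : Type*} [CommRing R] (p q : R[X]) (E : ℕ → R) :
    act (p + q) E = act p E + act q E := by
  simp [act]

lemma act_zero_right {R : Type*} [CommRing R] (p : R[X]) : act p (0 : ℕ → R) = 0 := by
  simp [act]

lemma act_one {R : Type*} [CommRing R] (E : ℕ → R) : act 1 E = E := by
  simp [act]

lemma act_apply' {R : Type*} [CommRing R] (p : R[X]) (E : ℕ → R) (m n : ℕ)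
    (hn : p.natDegree < n) :
    act p E m = ∑ i ∈ Finset.range n, p.coeff i * E (m + i) := by
  rw [act, aeval_eq_sum_range' hn]
  simp [Sh_pow]

lemma act_C_mul {R : Type*} [CommRing R] (c : R) (p : R[X]) (E : ℕ → R) (m : ℕ) :
    act (C c * p) E m = c * act p E m := by
  rw [act_mul, act, aeval_C, Module.algebraMap_end_apply]
  rfl

lemma act_lin {R : Type*} [CommRing R] (a b : R) (E : ℕ → R) (m : ℕ) :
    act (C b * X - C a) E m = b * E (m + 1) - a * E m := by
  have h := Sh_pow R 1 E m
  rw [pow_one] at h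
  simp [act, h, Module.End.mul_apply]

lemma act_X_sub {R : Type*} [CommRing R] (a : R) (E : ℕ → R) (m : ℕ) :
    act (X - C a) E m = E (m + 1) - a * E m := by
  have := act_lin a 1 E m
  simpa using this

lemma act_map {R S : Type*} [CommRing R] [CommRing S] (φ : R →+* S) (p : R[X]) (E : ℕ → R)
    (m : ℕ) : φ (act p E m) = act (p.map φ) (fun m => φ (E m)) m := by
  rw [act_apply' p E m (p.natDegree + 1) (by omega),
    act_apply' (p.map φ) _ m (p.natDegree + 1) (by have := natDegree_map_le (f := φ) (p := p); omega)]
  simp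

lemma act_of_dvd {R : Type*} [CommRing R] {p q : R[X]} (h : p ∣ q) {E : ℕ → R}
    (hp : act p E = 0) : act q E = 0 := by
  obtain ⟨r, rfl⟩ := h
  rw [mul_comm, act_mul, hp, act_zero_right]

lemma dvd_of_act {e : ℕ → ℝ} {c : ℝ} {j : ℕ} {p : ℝ[X]} (h1 : act ((X - C c) ^ (j + 1)) e = 0)
    (h0 : act ((X - C c) ^ j) e ≠ 0) (hp : act p e = 0) : (X - C c) ^ (j + 1) ∣ p := by
  have hg : act (EuclideanDomain.gcd p ((X - C c) ^ (j + 1))) e = 0 := by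
    rw [EuclideanDomain.gcd_eq_gcd_ab, act_add, act_of_dvd (dvd_mul_right _ _) hp,
      act_of_dvd (dvd_mul_right _ _) h1, add_zero]
  obtain ⟨i, hi, hass⟩ := (dvd_prime_pow (prime_X_sub_C c) _).1
    (EuclideanDomain.gcd_dvd_right p ((X - C c) ^ (j + 1)))
  rcases Nat.lt_or_ge i (j + 1) with h | h
  · exact absurd (act_of_dvd (hass.dvd.trans (pow_dvd_pow _ (by omega))) hg) h0
  · have : i = j + 1 := by omega
    subst this
    exact hass.symm.dvd.trans (EuclideanDomain.gcd_dvd_left _ _)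

lemma eq_zero_of_monic {f : ℝ[X]} (hf : f.Monic) {F : ℕ → ℝ} (h : act f F = 0)
    (h0 : ∀ m < f.natDegree, F m = 0) : F = 0 := by
  funext m
  induction m using Nat.strong_induction_on with
  | _ m ih =>
    rcases Nat.lt_or_ge m f.natDegree with hm | hm
    · exact h0 m hm
    · obtain ⟨l, rfl⟩ := Nat.exists_eq_add_of_le' hm
      have := congrFun h l
      rw [act_apply' f F l (f.natDegree + 1) (by omega), Finset.sum_range_succ,
        Finset.sum_eq_zero] at this
      · simpa [hf.coeff_natDegree] using this
      · intro i hi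
        rw [Finset.mem_range] at hi
        rw [ih (l + i) (by omega)]; simp

lemma eq_of_infinite {p q : ℝ[X]} {T : Set ℝ} (hT : T.Infinite)
    (h : ∀ s ∈ T, p.eval s = q.eval s) : p = q :=
  Polynomial.eq_of_infinite_eval_eq p q (hT.mono h)

lemma infinite_diff_roots {T : Set ℝ} (hT : T.Infinite) {p : ℝ[X]} (hp : p ≠ 0) :
    {s ∈ T | p.eval s ≠ 0}.Infinite := by
  have hfin : {s | p.eval s = 0}.Finite := by
    refine Set.Finite.subset (p.roots.toFinset.finite_toSet) ?_
    intro s hs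
    simp [hp, IsRoot.def]; exact hs
  exact hT.sdiff hfin

theorem key (E : ℕ → ℝ[X]) (g : ℝ → ℝ) (d : ℕ)
    (hE : ∀ s, act ((X - C (g s)) ^ d) (fun m => (E m).eval s) = 0)
    (hne : ∀ s, (fun m => (E m).eval s) ≠ 0) : ∃ q : ℝ[X], ∀ s, q.eval s = g s := by
  classical
  have hex : ∃ k, {s | act ((X - C (g s)) ^ k) (fun m => (E m).eval s) = 0}.Infinite :=
    ⟨d, by simpa [hE] using Set.infinite_univ⟩
  obtain ⟨k, hk, hmin⟩ : ∃ k, {s | act ((X - C (g s)) ^ k) (fun m => (E m).eval s) = 0}.Infinite ∧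
      ∀ j < k, ¬ {s | act ((X - C (g s)) ^ j) (fun m => (E m).eval s) = 0}.Infinite :=
    ⟨Nat.find hex, Nat.find_spec hex, fun j hj => Nat.find_min hex hj⟩
  obtain ⟨j, rfl⟩ : ∃ j, k = j + 1 := by
    cases k with
    | zero => simp [act_one, hne] at hk
    | succ j => exact ⟨j, rfl⟩
  have hT := hk.sdiff (Set.not_infinite.1 (hmin j (by omega)))
  set T := {s | act ((X - C (g s)) ^ (j + 1)) (fun m => (E m).eval s) = 0} \
    {s | act ((X - C (g s)) ^ j) (fun m => (E m).eval s) = 0} with hTdef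
  -- Hankel matrix
  have hnd : ∀ c : ℝ, ((X - C c) ^ (j + 1)).natDegree = j + 1 := fun c => by simp
  let H : Matrix (Fin (j + 2)) (Fin (j + 2)) ℝ[X] := Matrix.of fun a b => E (a + b)
  have hdet : H.det = 0 := by
    refine eq_of_infinite hT fun s hs => ?_
    rw [eval_zero, ← coe_evalRingHom, RingHom.map_det]
    rw [← Matrix.exists_mulVec_eq_zero_iff]
    refine ⟨fun b => ((X - C (g s)) ^ (j + 1)).coeff b, ?_, ?_⟩
    · intro h
      have h2 := congrFun h (Fin.last (j + 1))
      have h3 : ((X - C (g s)) ^ (j + 1)).Monic := (monic_X_sub_C _).pow _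
      have h4 := h3.coeff_natDegree
      rw [hnd] at h4
      simp only [Fin.val_last, h4] at h2
      exact one_ne_zero h2
    · funext a
      have h2 := congrFun hs.1 (a : ℕ)
      rw [act_apply' _ _ _ (j + 2) (by rw [hnd]; omega), Finset.sum_range] at h2
      simp only [Matrix.mulVec, dotProduct, H]
      simpa [mul_comm] using h2
  obtain ⟨v, hv0, hv⟩ := Matrix.exists_mulVec_eq_zero_iff.2 hdet
  obtain ⟨i0, hi0⟩ := Function.ne_iff.1 hv0
  have hT2 := infinite_diff_roots hT (p := v i0) (by simpa using hi0)
  set T2 := {s ∈ T | (v i0).eval s ≠ 0} with hT2def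
  -- main consequence
  have hmain : ∀ s ∈ T2, (v (Fin.last (j + 1))).eval s ≠ 0 ∧
      (C ((j : ℝ) + 1) * v (Fin.last (j + 1))).eval s * g s = (- v (Fin.last j).castSucc).eval s := by
    intro s hs
    obtain ⟨⟨hs1, hs0⟩, hsv⟩ := hs
    let w : ℕ → ℝ := fun i => if h : i < j + 2 then (v ⟨i, h⟩).eval s else 0
    let p : ℝ[X] := ∑ i ∈ Finset.range (j + 2), C (w i) * X ^ i
    have hpc : ∀ i < j + 2, p.coeff i = w i := by
      intro i hi
      simp only [p, finsetSum_coeff, coeff_C_mul, coeff_X_pow]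
      simp; omega
    have hpd : p.natDegree < j + 2 := by
      have : p.natDegree ≤ j + 1 := by
        refine natDegree_sum_le_of_forall_le _ _ fun i hi => ?_
        rw [Finset.mem_range] at hi
        exact (natDegree_C_mul_X_pow_le _ _).trans (by omega)
      omega
    have hp0 : act p (fun m => (E m).eval s) = 0 := by
      refine eq_zero_of_monic (f := (X - C (g s)) ^ (j + 1)) ((monic_X_sub_C _).pow _) ?_ ?_
      · rw [← act_mul, mul_comm, act_mul]
        have : act ((X - C (g s)) ^ (j + 1)) (fun m => (E m).eval s) = 0 := hs1
        rw [this, act_zero_right]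
      · intro m hm
        rw [hnd] at hm
        have h2 := congrArg (eval s) (congrFun hv ⟨m, by omega⟩)
        rw [act_apply' p _ m (j + 2) hpd]
        simp only [Matrix.mulVec, dotProduct, H, Matrix.of_apply, Pi.zero_apply, eval_zero,
          eval_finsetSum, eval_mul] at h2
        rw [← h2, Finset.sum_range]
        refine Finset.sum_congr rfl fun i _ => ?_
        rw [hpc i i.2, mul_comm]
        simp [w]
    obtain ⟨r, hr⟩ := dvd_of_act hs1 hs0 hp0
    have hpne : p ≠ 0 := by
      intro h
      have := hpc i0 i0.2
      simp [h, w] at this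
      exact hsv this.symm
    have hmon : ((X - C (g s)) ^ (j + 1)).Monic := (monic_X_sub_C _).pow _
    have hrne : r ≠ 0 := by rintro rfl; simp at hr; exact hpne hr
    have hrd : r.natDegree = 0 := by
      have := congrArg natDegree hr
      rw [hmon.natDegree_mul' hrne, hnd] at this
      omega
    obtain ⟨c, rfl⟩ := natDegree_eq_zero.1 hrd
    have hc : c ≠ 0 := by rintro rfl; simp at hrne
    have e1 : p.coeff (j + 1) = c := by
      rw [hr, coeff_mul_C]
      have h4 := hmon.coeff_natDegree
      rw [hnd] at h4
      rw [h4, one_mul]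
    have e2 : p.coeff j = - ((j : ℝ) + 1) * g s * c := by
      rw [hr, coeff_mul_C, sub_eq_add_neg, ← C_neg, coeff_X_add_C_pow]
      simp
      ring
    rw [hpc _ (by omega)] at e1 e2
    have f1 : (v (Fin.last (j + 1))).eval s = c := by
      rw [← e1]; simp [w]; rfl
    have f2 : (v (Fin.last j).castSucc).eval s = - ((j : ℝ) + 1) * g s * c := by
      rw [← e2]; simp [w]; rfl
    refine ⟨by rw [f1]; exact hc, ?_⟩
    rw [eval_neg, f2, eval_mul, f1, eval_C]; ring
  -- pass to coprime numerator and denominator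
  obtain ⟨a, b, hb0, hab, hgab⟩ : ∃ a b : ℝ[X], b ≠ 0 ∧ IsCoprime a b ∧
      ∃ T3 ⊆ T2, T3.Infinite ∧ ∀ s ∈ T3, b.eval s * g s = a.eval s ∧ b.eval s ≠ 0 := by
    set A := - v (Fin.last j).castSucc
    set B := C ((j : ℝ) + 1) * v (Fin.last (j + 1))
    have hj : ((j : ℝ) + 1) ≠ 0 := by positivity
    have hB : B ≠ 0 := by
      obtain ⟨s, hs⟩ := hT2.nonempty
      intro h
      have := (hmain s hs).1
      have h5 := congrArg (eval s) h
      simp [B, this, hj] at h5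
    obtain ⟨a, b, hc, e1, e2⟩ : ∃ a b, IsCoprime a b ∧ A = EuclideanDomain.gcd A B * a ∧
        B = EuclideanDomain.gcd A B * b := by
      obtain ⟨a, ha⟩ := EuclideanDomain.gcd_dvd_left A B
      obtain ⟨b, hb⟩ := EuclideanDomain.gcd_dvd_right A B
      refine ⟨a, b, ?_, ha, hb⟩
      have hg0 : EuclideanDomain.gcd A B ≠ 0 := by
        intro h; rw [h] at hb; simp at hb; exact hB hb
      refine ⟨EuclideanDomain.gcdA A B, EuclideanDomain.gcdB A B, ?_⟩
      have := EuclideanDomain.gcd_eq_gcd_ab A B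
      apply mul_left_cancel₀ hg0
      calc _ = (EuclideanDomain.gcd A B * a) * EuclideanDomain.gcdA A B +
          (EuclideanDomain.gcd A B * b) * EuclideanDomain.gcdB A B := by ring
        _ = _ := by rw [← ha, ← hb, ← this, mul_one]
    set G := EuclideanDomain.gcd A B
    have hb : b ≠ 0 := by rintro rfl; simp at e2; exact hB e2
    refine ⟨a, b, hb, hc, {s ∈ T2 | B.eval s ≠ 0}, Set.sep_subset _ _,
      infinite_diff_roots hT2 hB, ?_⟩
    rintro s ⟨hs, hBs⟩
    have h1 := (hmain s hs).2
    rw [e2, eval_mul] at hBs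
    change B.eval s * g s = A.eval s at h1
    rw [e1, e2, eval_mul, eval_mul] at h1
    refine ⟨mul_left_cancel₀ (left_ne_zero_of_mul hBs) (by rw [← h1]; ring),
      right_ne_zero_of_mul hBs⟩
  obtain ⟨T3, hT32, hT3, hg3⟩ := hgab
  have hlin : ∀ s ∈ T3, ∀ i, ((C b * X - C a) ^ i).map (evalRingHom s) =
      C (b.eval s ^ i) * (X - C (g s)) ^ i := by
    intro s hs i
    have : (C b * X - C a).map (evalRingHom s) = C (b.eval s) * (X - C (g s)) := by
      simp only [Polynomial.map_sub, Polynomial.map_mul, map_C, map_X, coe_evalRingHom,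
        ← (hg3 s hs).1, C_mul]
      ring
    rw [Polynomial.map_pow, this, mul_pow, C_pow]
  let W := act ((C b * X - C a) ^ j) E
  have hWs : ∀ s ∈ T3, ∀ m, (W m).eval s = b.eval s ^ j *
      act ((X - C (g s)) ^ j) (fun m => (E m).eval s) m := by
    intro s hs m
    have := act_map (evalRingHom s) ((C b * X - C a) ^ j) E m
    rw [hlin s hs] at this
    rw [← coe_evalRingHom]
    change (evalRingHom s) (act ((C b * X - C a) ^ j) E m) = _
    rw [this, act_C_mul]
    simp
  have hW1 : ∀ m, b * W (m + 1) = a * W m := by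
    intro m
    refine eq_of_infinite hT3 fun s hs => ?_
    have h1 := congrFun (hT32 hs).1.1 m
    rw [pow_succ', act_mul, act_X_sub] at h1
    rw [eval_mul, eval_mul, hWs s hs, hWs s hs, ← (hg3 s hs).1]
    simp only [Pi.zero_apply] at h1
    linear_combination (b.eval s * b.eval s ^ j) * h1
  have hW2 : ∀ m, b ^ m * W m = a ^ m * W 0 := by
    intro m
    induction m with
    | zero => simp
    | succ m ih => rw [pow_succ, mul_assoc, hW1, pow_succ]; linear_combination a * ih
  have hW0 : W 0 ≠ 0 := by
    intro h
    have hWz : ∀ m, W m = 0 := by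
      intro m
      have := hW2 m
      rw [h, mul_zero] at this
      exact (mul_eq_zero.1 this).resolve_left (pow_ne_zero _ hb0)
    obtain ⟨s, hs⟩ := hT3.nonempty
    apply (hT32 hs).1.2
    funext m
    have := hWs s hs m
    rw [hWz, eval_zero] at this
    exact (mul_eq_zero.1 this.symm).resolve_left (pow_ne_zero _ (hg3 s hs).2)
  have hbdeg : b.natDegree = 0 := by
    by_contra hbd
    have h1 : b ^ ((W 0).natDegree + 1) ∣ W 0 := by
      have : IsCoprime (b ^ ((W 0).natDegree + 1)) (a ^ ((W 0).natDegree + 1)) := hab.symm.pow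
      refine this.dvd_of_dvd_mul_left ?_
      rw [← hW2]; exact dvd_mul_right _ _
    have h2 := natDegree_le_of_dvd h1 hW0
    rw [natDegree_pow] at h2
    have : 1 ≤ b.natDegree := by omega
    nlinarith
  obtain ⟨c, rfl⟩ := natDegree_eq_zero.1 hbdeg
  have hc : c ≠ 0 := by rintro rfl; simp at hb0
  refine ⟨C c⁻¹ * a, fun s => ?_⟩
  set q := C c⁻¹ * a with hq
  have hq3 : ∀ s ∈ T3, q.eval s = g s := by
    intro s hs
    have := (hg3 s hs).1
    rw [hq, eval_mul, ← this]; simp [hc]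
  have hkill : ∀ m, act ((X - C q) ^ (j + 1)) E m = 0 := by
    intro m
    refine eq_of_infinite hT3 fun s hs => ?_
    have := act_map (evalRingHom s) ((X - C q) ^ (j + 1)) E m
    rw [← coe_evalRingHom, this]
    have h1 := congrFun (hT32 hs).1.1 m
    simpa [hq3 s hs] using h1
  by_contra hne2
  apply hne s
  have h1 : act ((X - C (q.eval s)) ^ (j + 1)) (fun m => (E m).eval s) = 0 := by
    funext m
    have := act_map (evalRingHom s) ((X - C q) ^ (j + 1)) E m
    rw [hkill] at this
    simpa using this.symm
  have hcop : IsCoprime ((X - C (q.eval s)) ^ (j + 1)) ((X - C (g s)) ^ d) :=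
    (isCoprime_X_sub_C_of_isUnit_sub (sub_ne_zero.2 hne2).isUnit).pow
  obtain ⟨x, y, hxy⟩ := hcop
  rw [← act_one (fun m => (E m).eval s), ← hxy, act_add, act_mul, act_mul, h1, hE,
    act_zero_right, act_zero_right, add_zero]

lemma act_geom (g : ℝ) (d : ℕ) (f : ℕ → ℝ) (m : ℕ) :
    act ((X - C g) ^ d) (fun m => g ^ m * f m) m = g ^ (m + d) * (fwdDiff 1)^[d] f m := by
  induction d generalizing m with
  | zero => simp [act_one]
  | succ d ih =>
    rw [pow_succ', act_mul, act_X_sub, ih, ih, Function.iterate_succ_apply', fwdDiff]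
    ring

lemma fwdDiff_poly (Q : ℝ[X]) (d : ℕ) (h : Q.natDegree < d) :
    (fwdDiff 1)^[d] (fun m : ℕ => Q.eval (m : ℝ)) = 0 := by
  have h1 := Polynomial.fwdDiff_iter_eq_zero_of_degree_lt (P := Q) h
  funext m
  have h2 := congrFun h1 (m : ℝ)
  rw [fwdDiff_iter_eq_sum_shift] at h2 ⊢
  simpa using h2

end Algebra
section Moments
open Polynomial MeasureTheory Set

lemma moment_measure (μ : Measure ℝ) [IsFiniteMeasure μ] (h : ℝ) (hh : 0 < h)
    (hsupp : μ (Ioo (-h) h)ᶜ = 0) (P : ℝ[X])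
    (hP : ∀ p ∈ Ioo (-h) h, (μ (Iio p)).toReal = P.eval p) (k : ℕ) :
    ∫ t, t ^ k ∂μ = ∫ t in (-h)..h, t ^ k * P.derivative.eval t := by
  have hmono : MonotoneOn (fun p => P.eval p) (Ioo (-h) h) := by
    intro a ha b hb hab
    change P.eval a ≤ P.eval b
    rw [← hP a ha, ← hP b hb]
    exact ENNReal.toReal_mono (measure_ne_top _ _) (measure_mono (Iio_subset_Iio hab))
  have hnn : ∀ t ∈ Ioo (-h) h, 0 ≤ P.derivative.eval t := by
    intro t ht
    have h1 := hmono.derivWithin_nonneg (x := t)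
    rwa [derivWithin_of_isOpen isOpen_Ioo ht, Polynomial.deriv] at h1
  set f : ℝ → NNReal := fun t => Real.toNNReal (P.derivative.eval t) with hf
  have hfm : Measurable f := by
    apply Measurable.real_toNNReal
    exact P.derivative.continuous.measurable
  set ν : Measure ℝ := volume.withDensity (fun t => (f t : ENNReal)) with hν
  have hIco : ∀ a ∈ Ioo (-h) h, ∀ b ∈ Ioo (-h) h, μ (Ico a b) = ν (Ico a b) := by
    intro a ha b hb
    rcases le_or_gt b a with hab | hab
    · simp [Ico_eq_empty (not_lt.2 hab)]
    have hsub : Icc a b ⊆ Ioo (-h) h := fun x hx => ⟨ha.1.trans_le hx.1, hx.2.trans_lt hb.2⟩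
    have h1 : μ (Ico a b) = ENNReal.ofReal (P.eval b - P.eval a) := by
      have hd : Ico a b = Iio b \ Iio a := by ext x; simp
      rw [hd, measure_sdiff (Iio_subset_Iio hab.le) nullMeasurableSet_Iio (measure_ne_top _ _),
        ← hP a ha, ← hP b hb, ENNReal.ofReal_sub _ ENNReal.toReal_nonneg,
        ENNReal.ofReal_toReal (measure_ne_top _ _), ENNReal.ofReal_toReal (measure_ne_top _ _)]
    have hint : IntervalIntegrable (fun t => P.derivative.eval t) volume a b :=
      P.derivative.continuous.intervalIntegrable _ _
    have h2 : ∫ t in a..b, P.derivative.eval t = P.eval b - P.eval a :=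
      intervalIntegral.integral_eq_sub_of_hasDerivAt (fun t _ => P.hasDerivAt t) hint
    rw [h1, hν, withDensity_apply _ measurableSet_Ico, ← h2,
      intervalIntegral.integral_of_le hab.le, ← integral_Ico_eq_integral_Ioc,
      ofReal_integral_eq_lintegral_ofReal]
    · rfl
    · exact ((intervalIntegrable_iff_integrableOn_Ico_of_le hab.le).1 hint)
    · refine (ae_restrict_iff' measurableSet_Ico).2 (Filter.Eventually.of_forall fun t ht => ?_)
      exact hnn t (hsub (Ico_subset_Icc_self ht))
  have hU : Ioo (-h) h = ⋃ r : {r : ℚ × ℚ // (r.1 : ℝ) ∈ Ioo (-h) h ∧ (r.2 : ℝ) ∈ Ioo (-h) h},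
      Ico (r.1.1 : ℝ) (r.1.2 : ℝ) := by
    ext t
    simp only [mem_iUnion]
    constructor
    · rintro ⟨h1, h2⟩
      obtain ⟨q1, hq1, hq1'⟩ := exists_rat_btwn h1
      obtain ⟨q2, hq2, hq2'⟩ := exists_rat_btwn h2
      exact ⟨⟨(q1, q2), ⟨hq1, hq1'.trans h2⟩, ⟨h1.trans hq2, hq2'⟩⟩, hq1'.le, hq2⟩
    · rintro ⟨⟨⟨q1, q2⟩, h1, h2⟩, h3, h4⟩
      exact ⟨h1.1.trans_le h3, h4.trans h2.2⟩
  have hres : μ.restrict (Ioo (-h) h) = ν.restrict (Ioo (-h) h) := by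
    rw [hU, Measure.restrict_iUnion_congr]
    rintro ⟨⟨q1, q2⟩, h1, h2⟩
    refine Measure.ext_of_Ico _ _ fun a b hab => ?_
    rw [Measure.restrict_apply measurableSet_Ico, Measure.restrict_apply measurableSet_Ico,
      Ico_inter_Ico]
    simp only at h1 h2 ⊢
    rcases le_or_gt (min b (q2 : ℝ)) (max a (q1 : ℝ)) with hle | hlt
    · simp [Ico_eq_empty (not_lt.2 hle)]
    · have e1 : (q1 : ℝ) ≤ max a (q1 : ℝ) := le_max_right _ _
      have e2 : min b (q2 : ℝ) ≤ (q2 : ℝ) := min_le_right _ _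
      exact hIco _ ⟨h1.1.trans_le e1, (hlt.trans_le e2).trans h2.2⟩ _
        ⟨(h1.1.trans_le e1).trans hlt, e2.trans_lt h2.2⟩
  have hμ : μ = μ.restrict (Ioo (-h) h) := by
    rw [Measure.restrict_eq_self_of_ae_mem]
    exact hsupp
  rw [hμ, hres, hν, restrict_withDensity measurableSet_Ioo,
    integral_withDensity_eq_integral_smul hfm, intervalIntegral.integral_of_le (by linarith),
    ← integral_Ioc_eq_integral_Ioo]
  rw [integral_Ioc_eq_integral_Ioo, integral_Ioc_eq_integral_Ioo]
  refine setIntegral_congr_fun measurableSet_Ioo fun t ht => ?_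
  simp only [hf, NNReal.smul_def, Real.coe_toNNReal _ (hnn t ht), smul_eq_mul]
  ring

lemma moment_poly (h : ℝ) (R : ℝ[X]) (N : ℕ) (hR : R.natDegree ≤ N) :
    ∃ Q : ℝ[X], Q.natDegree < N + 1 ∧ ∀ m : ℕ,
      (∫ t in (-h)..h, t ^ (2 * m) * R.eval t) *
        ∏ i ∈ Finset.range (N + 1), (2 * (m : ℝ) + i + 1) = (h ^ 2) ^ m * Q.eval (m : ℝ) := by
  refine ⟨∑ j ∈ Finset.range (N + 1), C (R.coeff j * (h ^ (j + 1) - (-h) ^ (j + 1))) *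
    ∏ i ∈ (Finset.range (N + 1)).erase j, (C 2 * X + C ((i : ℝ) + 1)), ?_, ?_⟩
  · rw [Nat.lt_succ_iff]
    refine natDegree_sum_le_of_forall_le _ _ fun j hj => ?_
    refine (natDegree_C_mul_le _ _).trans ((natDegree_prod_le _ _).trans ?_)
    refine (Finset.sum_le_card_nsmul _ _ 1 fun i _ => natDegree_linear_le).trans ?_
    rw [Finset.card_erase_of_mem hj]; simp
  · intro m
    have h1 : ∀ t : ℝ, t ^ (2 * m) * R.eval t =
        ∑ j ∈ Finset.range (N + 1), R.coeff j * t ^ (2 * m + j) := by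
      intro t
      rw [eval_eq_sum_range' (Nat.lt_succ_of_le hR), Finset.mul_sum]
      exact Finset.sum_congr rfl fun j _ => by ring
    simp_rw [h1]
    rw [intervalIntegral.integral_finsetSum
      (fun j _ => (by fun_prop : Continuous fun t : ℝ => R.coeff j * t ^ (2 * m + j)).intervalIntegrable _ _)]
    rw [eval_finsetSum, Finset.sum_mul, Finset.mul_sum]
    refine Finset.sum_congr rfl fun j hj => ?_
    rw [intervalIntegral.integral_const_mul, integral_pow, ← Finset.mul_prod_erase _ _ hj]
    simp only [eval_mul, eval_C, eval_prod, eval_add, eval_X]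
    have : (2 * (m : ℝ) + j + 1) ≠ 0 := by positivity
    have e : (-h) ^ (2 * m + j + 1) = (h ^ 2) ^ m * (-h) ^ (j + 1) := by
      rw [add_assoc, pow_add, pow_mul]; simp
    rw [e, add_assoc (2 * m) j 1, pow_add, pow_mul]
    have e3 : ∏ i ∈ (Finset.range (N + 1)).erase j, (2 * (m : ℝ) + i + 1) =
      ∏ i ∈ (Finset.range (N + 1)).erase j, (2 * (m : ℝ) + (i + 1)) :=
      Finset.prod_congr rfl fun i _ => by ring
    rw [e3]
    push_cast
    field_simp
end Moments
section Quad
open Polynomial Filter Topology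

lemma quad_of_inversion (p1 p2 : ℝ[X])
    (h : ∀ s : ℝ, s ≠ 0 → p1.eval s = s ^ 2 * p2.eval s⁻¹) :
    p1.eval 1 + p1.eval (-1) = 2 * p1.eval 0 + 2 * p2.eval 0 := by
  have hlim : Tendsto (fun s : ℝ => p1.eval s / (X ^ 2 : ℝ[X]).eval s) atTop (𝓝 (p2.eval 0)) := by
    have h1 : Tendsto (fun s : ℝ => p2.eval s⁻¹) atTop (𝓝 (p2.eval 0)) :=
      (p2.continuous.tendsto 0).comp tendsto_inv_atTop_zero
    refine h1.congr' ?_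
    filter_upwards [eventually_gt_atTop 0] with s hs
    rw [h s hs.ne']
    simp [hs.ne']
  have hdeg : p1.degree ≤ 2 := by
    by_contra hd
    rw [not_le] at hd
    have := abs_div_tendsto_atTop_atTop_of_degree_gt p1 (X ^ 2 : ℝ[X]) (by simpa using hd) (by simp)
    exact not_tendsto_nhds_of_tendsto_atTop this _ hlim.abs
  have hnd : p1.natDegree < 3 := by
    have := natDegree_le_of_degree_le (n := 2) hdeg
    omega
  have hev : ∀ s, p1.eval s = p1.coeff 0 + p1.coeff 1 * s + p1.coeff 2 * s ^ 2 := by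
    intro s
    rw [eval_eq_sum_range' hnd]
    simp [Finset.sum_range_succ]
  have hlim2 : Tendsto (fun s : ℝ => p1.eval s / (X ^ 2 : ℝ[X]).eval s) atTop
      (𝓝 (p1.coeff 0 * 0 ^ 2 + p1.coeff 1 * 0 + p1.coeff 2)) := by
    have hi : Tendsto (fun s : ℝ => s⁻¹) atTop (𝓝 0) := tendsto_inv_atTop_zero
    have := (((hi.pow 2).const_mul (p1.coeff 0)).add (hi.const_mul (p1.coeff 1))).add_const
      (p1.coeff 2)
    refine this.congr' ?_
    filter_upwards [eventually_gt_atTop 0] with s hs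
    rw [hev]
    simp only [eval_pow, eval_X]
    field_simp
  have he := tendsto_nhds_unique hlim hlim2
  rw [hev 1, hev (-1), hev 0, he]
  ring

/-- Type synonym used to carry an auxiliary norm. -/
def Syn (E : Type*) : Type _ := E

lemma exists_euclid_of_parallelogram {F : Type*} [NormedAddCommGroup F] [NormedSpace ℝ F] (n : ℕ)
    [Module.Finite ℝ F] (hn : Module.finrank ℝ F = n)
    (h : ∀ x y : F, ‖x + y‖ * ‖x + y‖ + ‖x - y‖ * ‖x - y‖ = 2 * (‖x‖ * ‖x‖ + ‖y‖ * ‖y‖)) :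
    ∃ Φ : F ≃ₗ[ℝ] EuclideanSpace ℝ (Fin n), ∀ x, ‖Φ x‖ = ‖x‖ := by
  letI : InnerProductSpace ℝ F := InnerProductSpace.ofNorm ℝ h
  let b := (stdOrthonormalBasis ℝ F).reindex (finCongr hn)
  exact ⟨b.repr.toLinearEquiv, fun x => b.repr.norm_map x⟩

lemma exists_euclid {n : ℕ} (f : EuclideanSpace ℝ (Fin n) → ℝ)
    (hadd : ∀ x y, f (x + y) ≤ f x + f y) (hsmul : ∀ (r : ℝ) x, f (r • x) = |r| * f x)
    (hpos : ∀ x, x ≠ 0 → 0 < f x)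
    (hpar : ∀ x y, f (x + y) ^ 2 + f (x - y) ^ 2 = 2 * (f x ^ 2 + f y ^ 2)) :
    ∃ Φ : EuclideanSpace ℝ (Fin n) ≃ₗ[ℝ] EuclideanSpace ℝ (Fin n), ∀ x, ‖Φ x‖ = f x := by
  have h0 : f 0 = 0 := by simpa using hsmul 0 0
  letI i1 : AddCommGroup (Syn (EuclideanSpace ℝ (Fin n))) :=
    inferInstanceAs (AddCommGroup (EuclideanSpace ℝ (Fin n)))
  letI i2 : Module ℝ (Syn (EuclideanSpace ℝ (Fin n))) :=
    inferInstanceAs (Module ℝ (EuclideanSpace ℝ (Fin n)))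
  let N : AddGroupNorm (Syn (EuclideanSpace ℝ (Fin n))) :=
    { toFun := f
      map_zero' := h0
      add_le' := hadd
      neg' := fun x => by
        have h1 : ∀ y : EuclideanSpace ℝ (Fin n), f (-y) = f y := fun y => by
          have := hsmul (-1) y
          simpa only [neg_smul, one_smul, abs_neg, abs_one, one_mul] using this
        exact h1 x
      eq_zero_of_map_eq_zero' := fun x hx => by
        by_contra hne
        exact (hpos x hne).ne' hx }
  letI i3 : NormedAddCommGroup (Syn (EuclideanSpace ℝ (Fin n))) := N.toNormedAddCommGroup
  letI i4 : NormedSpace ℝ (Syn (EuclideanSpace ℝ (Fin n))) :=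
    { i2 with norm_smul_le := fun r x => (hsmul r x).le }
  haveI i5 : Module.Finite ℝ (Syn (EuclideanSpace ℝ (Fin n))) :=
    inferInstanceAs (Module.Finite ℝ (EuclideanSpace ℝ (Fin n)))
  obtain ⟨Φ, hΦ⟩ := exists_euclid_of_parallelogram (F := Syn (EuclideanSpace ℝ (Fin n))) n
    (finrank_euclideanSpace_fin (𝕜 := ℝ) (n := n)) (fun x y => by
      have := hpar x y
      simp only [← pow_two]
      exact this)
  exact ⟨Φ, hΦ⟩

end Quad

section Body
open Polynomial MeasureTheory Set

variable {n : ℕ}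

/-- Support function. -/
noncomputable def supp (D : Set (EuclideanSpace ℝ (Fin n))) (ω : EuclideanSpace ℝ (Fin n)) : ℝ :=
  sSup ((fun x => ⟪x, ω⟫) '' D)

/-- Moments in direction `ω`. -/
noncomputable def mom (D : Set (EuclideanSpace ℝ (Fin n))) (k : ℕ)
    (ω : EuclideanSpace ℝ (Fin n)) : ℝ := ∫ x in D, ⟪x, ω⟫ ^ k

lemma bdd_image {D : Set (EuclideanSpace ℝ (Fin n))} (hbdd : Bornology.IsBounded D)
    (ω : EuclideanSpace ℝ (Fin n)) : BddAbove ((fun x => ⟪x, ω⟫) '' D) := by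
  obtain ⟨R, hR⟩ := hbdd.exists_norm_le
  refine ⟨R * ‖ω‖, ?_⟩
  rintro _ ⟨x, hx, rfl⟩
  exact (real_inner_le_norm x ω).trans (mul_le_mul_of_nonneg_right (hR x hx) (norm_nonneg _))

lemma le_supp {D : Set (EuclideanSpace ℝ (Fin n))} (hbdd : Bornology.IsBounded D)
    (ω : EuclideanSpace ℝ (Fin n)) {x} (hx : x ∈ D) : ⟪x, ω⟫ ≤ supp D ω :=
  le_csSup (bdd_image hbdd ω) ⟨x, hx, rfl⟩

lemma supp_le {D : Set (EuclideanSpace ℝ (Fin n))} (hne : D.Nonempty)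
    (ω : EuclideanSpace ℝ (Fin n)) {c : ℝ} (h : ∀ x ∈ D, ⟪x, ω⟫ ≤ c) : supp D ω ≤ c := by
  refine csSup_le (hne.image _) ?_
  rintro _ ⟨x, hx, rfl⟩
  exact h x hx

lemma lt_supp {D : Set (EuclideanSpace ℝ (Fin n))} (hbdd : Bornology.IsBounded D) (hopen : IsOpen D)
    {ω : EuclideanSpace ℝ (Fin n)} (hω : ω ≠ 0) {x} (hx : x ∈ D) : ⟪x, ω⟫ < supp D ω := by
  have hc : Continuous fun t : ℝ => x + t • ω := by fun_prop
  have h0 : ∀ᶠ t in nhdsWithin (0 : ℝ) (Ioi 0), x + t • ω ∈ D := by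
    apply (hc.tendsto 0).eventually_mem _ |>.filter_mono nhdsWithin_le_nhds
    simpa using hopen.mem_nhds hx
  obtain ⟨t, ht, ht0⟩ := (h0.and self_mem_nhdsWithin).exists
  have := le_supp hbdd ω ht
  rw [inner_add_left, inner_smul_left, real_inner_self_eq_norm_sq] at this
  have h2 : 0 < t * ‖ω‖ ^ 2 := mul_pos ht0 (by positivity)
  simp at this
  linarith

lemma supp_add {D : Set (EuclideanSpace ℝ (Fin n))} (hbdd : Bornology.IsBounded D) (hne : D.Nonempty)
    (u v : EuclideanSpace ℝ (Fin n)) : supp D (u + v) ≤ supp D u + supp D v := by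
  refine supp_le hne _ fun x hx => ?_
  rw [inner_add_right]
  exact add_le_add (le_supp hbdd u hx) (le_supp hbdd v hx)

lemma supp_smul_nonneg {D : Set (EuclideanSpace ℝ (Fin n))} 
    {r : ℝ} (hr : 0 ≤ r) (u : EuclideanSpace ℝ (Fin n)) : supp D (r • u) = r * supp D u := by
  rw [supp, supp, ← smul_eq_mul, ← Real.sSup_smul_of_nonneg hr]
  congr 1
  ext y
  simp [Set.mem_smul_set, inner_smul_right]

lemma supp_neg {D : Set (EuclideanSpace ℝ (Fin n))} (hsymm : D = -D)
    (u : EuclideanSpace ℝ (Fin n)) : supp D (-u) = supp D u := by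
  rw [supp, supp]
  congr 1
  ext y
  constructor
  · rintro ⟨x, hx, rfl⟩
    rw [hsymm] at hx
    exact ⟨-x, hx, by simp⟩
  · rintro ⟨x, hx, rfl⟩
    rw [hsymm] at hx
    exact ⟨-x, hx, by simp⟩

lemma sInf_eq {D : Set (EuclideanSpace ℝ (Fin n))} (hsymm : D = -D)
    (u : EuclideanSpace ℝ (Fin n)) : sInf ((fun x => ⟪x, u⟫) '' D) = - supp D u := by
  rw [← supp_neg hsymm, Real.sInf_def, supp]
  congr 2
  ext y
  simp only [Set.mem_neg, Set.mem_image, inner_neg_right]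
  constructor
  · rintro ⟨x, hx, h⟩; exact ⟨x, hx, by linarith⟩
  · rintro ⟨x, hx, h⟩; exact ⟨x, hx, by linarith⟩

lemma supp_smul {D : Set (EuclideanSpace ℝ (Fin n))} (hsymm : D = -D)
    (r : ℝ) (u : EuclideanSpace ℝ (Fin n)) : supp D (r • u) = |r| * supp D u := by
  rcases le_total 0 r with h | h
  · rw [supp_smul_nonneg h, abs_of_nonneg h]
  · rw [← supp_neg hsymm, ← neg_smul, supp_smul_nonneg (by linarith), abs_of_nonpos h]

lemma supp_zero {D : Set (EuclideanSpace ℝ (Fin n))} : supp D 0 = 0 := by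
  simpa using supp_smul_nonneg (D := D) le_rfl 0

lemma zero_mem {D : Set (EuclideanSpace ℝ (Fin n))} (hsymm : D = -D) (hconv : Convex ℝ D)
    (hne : D.Nonempty) : (0 : EuclideanSpace ℝ (Fin n)) ∈ D := by
  obtain ⟨x, hx⟩ := hne
  have hx' : -x ∈ D := by rw [hsymm]; simpa using hx
  have := hconv hx hx' (a := 1 / 2) (b := 1 / 2) (by norm_num) (by norm_num) (by norm_num)
  simpa using this

lemma supp_pos {D : Set (EuclideanSpace ℝ (Fin n))} (hbdd : Bornology.IsBounded D) (hopen : IsOpen D)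
    (h0 : (0 : EuclideanSpace ℝ (Fin n)) ∈ D)
    {ω : EuclideanSpace ℝ (Fin n)} (hω : ω ≠ 0) : 0 < supp D ω := by
  simpa using lt_supp hbdd hopen hω h0

lemma mom_unit {D : Set (EuclideanSpace ℝ (Fin n))} (hopen : IsOpen D)
    (hbdd : Bornology.IsBounded D) (hsymm : D = -D) (h0 : (0 : EuclideanSpace ℝ (Fin n)) ∈ D)
    (ω : EuclideanSpace ℝ (Fin n)) (hω : ω ≠ 0) (P : ℝ[X])
    (hP : ∀ p : ℝ, sInf ((fun x => ⟪x, ω⟫) '' D) < p → p < sSup ((fun x => ⟪x, ω⟫) '' D) →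
          (MeasureTheory.volume (D ∩ {x : EuclideanSpace ℝ (Fin n) | ⟪x, ω⟫ < p})).toReal =
            P.eval p) (k : ℕ) :
    mom D k ω = ∫ t in (-(supp D ω))..(supp D ω), t ^ k * P.derivative.eval t := by
  have hm : Measurable fun x : EuclideanSpace ℝ (Fin n) => ⟪x, ω⟫ := by fun_prop
  have hfin : volume D ≠ ⊤ := hbdd.measure_lt_top.ne
  haveI : IsFiniteMeasure (volume.restrict D) := ⟨by simpa using hfin.lt_top⟩
  set μ := (volume.restrict D).map (fun x : EuclideanSpace ℝ (Fin n) => ⟪x, ω⟫) with hμ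
  haveI : IsFiniteMeasure μ := by rw [hμ]; infer_instance
  rw [← moment_measure μ (supp D ω) (supp_pos hbdd hopen h0 hω) ?_ P ?_ k]
  · rw [hμ, integral_map hm.aemeasurable (by fun_prop)]
    rfl
  · rw [hμ, Measure.map_apply hm measurableSet_Ioo.compl,
      Measure.restrict_apply (hm measurableSet_Ioo.compl)]
    convert measure_empty (μ := volume)
    rw [Set.eq_empty_iff_forall_notMem]
    rintro x ⟨hx, hxD⟩
    apply hx
    refine ⟨?_, lt_supp hbdd hopen hω hxD⟩
    have hx' : -x ∈ D := by rw [hsymm]; simpa using hxD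
    have := lt_supp hbdd hopen hω hx'
    rw [inner_neg_left] at this
    linarith
  · rintro p ⟨hp1, hp2⟩
    rw [← hP p (by rw [sInf_eq hsymm]; exact hp1) hp2, hμ, Measure.map_apply hm measurableSet_Iio,
      Measure.restrict_apply (hm measurableSet_Iio), inter_comm]
    rfl

lemma mom_smul (D : Set (EuclideanSpace ℝ (Fin n))) (k : ℕ) (r : ℝ)
    (ω : EuclideanSpace ℝ (Fin n)) : mom D k (r • ω) = r ^ k * mom D k ω := by
  simp only [mom, inner_smul_right, mul_pow]
  exact integral_const_mul _ _

lemma mom_form {D : Set (EuclideanSpace ℝ (Fin n))} (hopen : IsOpen D)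
    (hbdd : Bornology.IsBounded D) (hsymm : D = -D) (h0 : (0 : EuclideanSpace ℝ (Fin n)) ∈ D)
    (N : ℕ)
    (hN : ∀ ω : EuclideanSpace ℝ (Fin n), ‖ω‖ = 1 →
      ∃ P : Polynomial ℝ, P.degree ≤ (N : ℕ) ∧
        ∀ p : ℝ, sInf ((fun x => ⟪x, ω⟫) '' D) < p → p < sSup ((fun x => ⟪x, ω⟫) '' D) →
          (MeasureTheory.volume (D ∩ {x : EuclideanSpace ℝ (Fin n) | ⟪x, ω⟫ < p})).toReal =
            P.eval p) (ω : EuclideanSpace ℝ (Fin n)) :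
    ∃ Q : ℝ[X], Q.natDegree < N + 1 ∧ ∀ m : ℕ, mom D (2 * m) ω *
        ∏ i ∈ Finset.range (N + 1), (2 * (m : ℝ) + i + 1) = (supp D ω ^ 2) ^ m * Q.eval (m : ℝ) := by
  by_cases hω : ω = 0
  · subst hω
    refine ⟨C (mom D 0 0 * ∏ i ∈ Finset.range (N + 1), (2 * ((0 : ℕ) : ℝ) + i + 1)),
      by rw [natDegree_C]; omega, fun m => ?_⟩
    rw [eval_C]
    cases m with
    | zero => simp
    | succ m => simp [supp_zero, mom]
  · have hn : ‖ω‖ ≠ 0 := by simpa using hω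
    set ω' := ‖ω‖⁻¹ • ω with hω'
    have h1 : ‖ω'‖ = 1 := by rw [hω', norm_smul]; simp [hn]
    have h2 : ω = ‖ω‖ • ω' := by rw [hω', smul_smul, mul_inv_cancel₀ hn, one_smul]
    have h3 : ω' ≠ 0 := by rw [← norm_ne_zero_iff, h1]; exact one_ne_zero
    obtain ⟨P, hPd, hP⟩ := hN ω' h1
    have hPn : P.derivative.natDegree ≤ N :=
      (natDegree_derivative_le P).trans ((Nat.sub_le _ _).trans (natDegree_le_of_degree_le hPd))
    obtain ⟨Q, hQ, hQm⟩ := moment_poly (supp D ω') P.derivative N hPn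
    refine ⟨Q, hQ, fun m => ?_⟩
    have e := mom_unit hopen hbdd hsymm h0 ω' h3 P hP (2 * m)
    have := hQm m
    rw [← e] at this
    rw [h2, mom_smul, supp_smul_nonneg (norm_nonneg _), mul_assoc, this, pow_mul, mul_pow, mul_pow]
    ring

lemma mom_line {D : Set (EuclideanSpace ℝ (Fin n))} 
    (hbdd : Bornology.IsBounded D) (k : ℕ) (u v : EuclideanSpace ℝ (Fin n)) :
    ∃ q : ℝ[X], ∀ s, q.eval s = mom D k (u + s • v) := by
  refine ⟨∑ i ∈ Finset.range (k + 1), C (∫ x in D, ⟪x, u⟫ ^ i * ⟪x, v⟫ ^ (k - i) * (k.choose i)) *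
    X ^ (k - i), fun s => ?_⟩
  have hint : ∀ f : EuclideanSpace ℝ (Fin n) → ℝ, Continuous f → IntegrableOn f D volume := by
    intro f hf
    exact (hf.continuousOn.integrableOn_compact hbdd.isCompact_closure).mono_set subset_closure
  simp only [mom, inner_add_right, inner_smul_right, add_pow]
  rw [integral_finsetSum _ (fun i _ => hint _ (by fun_prop)), eval_finsetSum]
  refine Finset.sum_congr rfl fun i _ => ?_
  rw [eval_mul, eval_C, eval_pow, eval_X, ← integral_mul_const]
  congr 1
  funext x
  ring

theorem supp_sq_line {D : Set (EuclideanSpace ℝ (Fin n))} (hopen : IsOpen D)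
    (hbdd : Bornology.IsBounded D) (hsymm : D = -D) (h0 : (0 : EuclideanSpace ℝ (Fin n)) ∈ D)
    (N : ℕ)
    (hN : ∀ ω : EuclideanSpace ℝ (Fin n), ‖ω‖ = 1 →
      ∃ P : Polynomial ℝ, P.degree ≤ (N : ℕ) ∧
        ∀ p : ℝ, sInf ((fun x => ⟪x, ω⟫) '' D) < p → p < sSup ((fun x => ⟪x, ω⟫) '' D) →
          (MeasureTheory.volume (D ∩ {x : EuclideanSpace ℝ (Fin n) | ⟪x, ω⟫ < p})).toReal =
            P.eval p) (u v : EuclideanSpace ℝ (Fin n)) :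
    ∃ q : ℝ[X], ∀ s, q.eval s = supp D (u + s • v) ^ 2 := by
  choose q hq using fun m : ℕ => mom_line hbdd (2 * m) u v
  refine key (fun m => q m * C (∏ i ∈ Finset.range (N + 1), (2 * (m : ℝ) + i + 1)))
    (fun s => supp D (u + s • v) ^ 2) (N + 1) ?_ ?_
  · intro s
    obtain ⟨Q, hQ, hQm⟩ := mom_form hopen hbdd hsymm h0 N hN (u + s • v)
    funext m
    simp only [eval_mul, eval_C, hq, hQm]
    rw [act_geom, fwdDiff_poly Q _ hQ]
    simp
  · intro s h
    have := congrFun h 0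
    simp only [eval_mul, eval_C, hq, mom, Pi.zero_apply] at this
    have hvol : volume.real D ≠ 0 := by
      rw [Measure.real, ENNReal.toReal_ne_zero]
      exact ⟨(hopen.measure_pos volume ⟨0, h0⟩).ne', hbdd.measure_lt_top.ne⟩
    have hp : ∏ i ∈ Finset.range (N + 1), (2 * ((0 : ℕ) : ℝ) + i + 1) ≠ 0 :=
      Finset.prod_ne_zero_iff.2 fun i _ => by positivity
    rcases mul_eq_zero.1 this with h | h
    · simp at h
      exact hvol h
    · exact hp h

end Body

theorem stmt13 (n : ℕ) (hn : 2 ≤ n) (D : Set (EuclideanSpace ℝ (Fin n)))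
    (hopen : IsOpen D) (hbdd : Bornology.IsBounded D) (hconv : Convex ℝ D)
    (hsymm : D = -D) (hne : D.Nonempty)
    (hN : ∃ N : ℕ, ∀ ω : EuclideanSpace ℝ (Fin n), ‖ω‖ = 1 →
      ∃ P : Polynomial ℝ, P.degree ≤ (N : ℕ) ∧
        ∀ p : ℝ, sInf ((fun x => ⟪x, ω⟫) '' D) < p → p < sSup ((fun x => ⟪x, ω⟫) '' D) →
          (MeasureTheory.volume (D ∩ {x : EuclideanSpace ℝ (Fin n) | ⟪x, ω⟫ < p})).toReal =
            P.eval p) :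
    ∃ T : EuclideanSpace ℝ (Fin n) ≃ₗ[ℝ] EuclideanSpace ℝ (Fin n),
      D = T '' Metric.ball (0 : EuclideanSpace ℝ (Fin n)) 1 := by
  obtain ⟨N, hN⟩ := hN
  have h0 := zero_mem hsymm hconv hne
  have hline := supp_sq_line hopen hbdd hsymm h0 N hN
  obtain ⟨Φ, hΦ⟩ := exists_euclid (supp D) (supp_add hbdd hne) (supp_smul hsymm)
    (fun x hx => supp_pos hbdd hopen h0 hx) (by
      intro x y
      obtain ⟨p1, hp1⟩ := hline x y
      obtain ⟨p2, hp2⟩ := hline y x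
      have := quad_of_inversion p1 p2 (fun s hs => by
        rw [hp1, hp2, ← sq_abs s, ← mul_pow, ← supp_smul hsymm, smul_add, smul_smul,
          mul_inv_cancel₀ hs, one_smul, add_comm])
      rw [hp1, hp1, hp1, hp2] at this
      simp only [one_smul, neg_smul, zero_smul, add_zero, ← sub_eq_add_neg] at this
      rw [this]; ring)
  -- the adjoint of the inverse
  let A : EuclideanSpace ℝ (Fin n) →ₗ[ℝ] EuclideanSpace ℝ (Fin n) := LinearMap.adjoint Φ.symm.toLinearMap
  have hA : ∀ x y, ⟪A x, y⟫ = ⟪x, Φ.symm y⟫ := fun x y => LinearMap.adjoint_inner_left _ _ _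
  have hinj : Function.Injective A := by
    rw [injective_iff_map_eq_zero]
    intro x hx
    have h1 := hA x (Φ x)
    rw [hx, Φ.symm_apply_apply, inner_zero_left] at h1
    exact inner_self_eq_zero.1 h1.symm
  let S := LinearEquiv.ofInjectiveEndo A hinj
  refine ⟨S.symm, ?_⟩
  have hmem : ∀ x, x ∈ D ↔ ‖A x‖ < 1 := by
    intro x
    constructor
    · intro hx
      by_cases hAx : A x = 0
      · rw [hAx]; simp
      · have hne' : Φ.symm (A x) ≠ 0 := by simpa using hAx
        have h1 := lt_supp hbdd hopen hne' hx
        rw [← hA, ← hΦ, Φ.apply_symm_apply, real_inner_self_eq_norm_sq] at h1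
        have h2 : 0 < ‖A x‖ := norm_pos_iff.2 hAx
        nlinarith
    · intro hx
      by_contra hxD
      obtain ⟨f, hf⟩ := geometric_hahn_banach_open_point hconv hopen hxD
      obtain ⟨ω, hω⟩ := (InnerProductSpace.toDual ℝ (EuclideanSpace ℝ (Fin n))).surjective f
      have hf' : ∀ y, f y = ⟪y, ω⟫ := by
        intro y
        rw [← hω, InnerProductSpace.toDual_apply_apply, real_inner_comm]
      have hle : supp D ω ≤ ⟪x, ω⟫ := by
        refine supp_le hne _ fun y hy => ?_
        rw [← hf', ← hf']
        exact (hf y hy).le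
      have hω0 : ω ≠ 0 := by
        rintro rfl
        have := hf 0 h0
        rw [hf', hf'] at this
        simp at this
      have h1 := hA x (Φ ω)
      rw [Φ.symm_apply_apply] at h1
      rw [← h1, ← hΦ] at hle
      have h2 := real_inner_le_norm (A x) (Φ ω)
      have h3 : 0 < ‖Φ ω‖ := by rw [hΦ]; exact supp_pos hbdd hopen h0 hω0
      nlinarith
  ext x
  rw [hmem]
  constructor
  · intro hx
    exact ⟨A x, by simpa using hx, S.symm_apply_apply x⟩
  · rintro ⟨y, hy, rfl⟩
    have : A (S.symm y) = y := S.apply_symm_apply y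
    rw [this]
    simpa using hy
end
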